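/- arXiv:1911.03574 — 6 statements merged into one kernel-verified Lean document; each statement's English description precedes it below -/
import Mathlib

section
/- Let b > 0, let Z ~ Laplace(0,b), and let h: ℝ → ℝ be Lipschitz with E|h(Z)| < ∞. Set h̃(x) = h(x) − E[h(Z)] and define f(x) = (1/(2b))·( e^{x/b} ∫_x^∞ e^{−t/b} h̃(t) dt + e^{−x/b} ∫_{−∞}^x e^{t/b} h̃(t) dt ). Then for all x ∈ ℝ, |f(x)| ≤ (2b + |x|)·‖h'‖_∞, where ‖h'‖_∞ denotes the Lipschitz constant of h. -/
open MeasureTheory ProbabilityTheory Real Set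

/-- The Laplace(0,b) distribution on ℝ, with density (1/(2b))·exp(−|x|/b). -/
noncomputable def laplaceDist (b : ℝ) : Measure ℝ :=
  (volume : Measure ℝ).withDensity fun x => ENNReal.ofReal (Real.exp (-|x| / b) / (2 * b))

/-- Kolmogorov distance between two laws on ℝ. -/
noncomputable def kolDist (μ ν : Measure ℝ) : ℝ :=
  ⨆ z : ℝ, |(μ (Iic z)).toReal - (ν (Iic z)).toReal|

/-- Wasserstein distance between two laws on ℝ: sup over 1-Lipschitz test functions. -/
noncomputable def wassDist (μ ν : Measure ℝ) : ℝ :=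
  ⨆ h : {h : ℝ → ℝ // LipschitzWith 1 h}, |(∫ x, h.1 x ∂μ) - ∫ x, h.1 x ∂ν|

/-- d₂ distance: sup over differentiable h with 1-Lipschitz derivative. -/
noncomputable def d2Dist (μ ν : Measure ℝ) : ℝ :=
  ⨆ h : {h : ℝ → ℝ // Differentiable ℝ h ∧ LipschitzWith 1 (deriv h)},
    |(∫ x, h.1 x ∂μ) - ∫ x, h.1 x ∂ν|

/-- d₁,₂ distance: sup over differentiable h with ‖h'‖∞ ≤ 1 and 1-Lipschitz derivative. -/
noncomputable def d12Dist (μ ν : Measure ℝ) : ℝ :=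
  ⨆ h : {h : ℝ → ℝ //
      Differentiable ℝ h ∧ (∀ x, |deriv h x| ≤ 1) ∧ LipschitzWith 1 (deriv h)},
    |(∫ x, h.1 x ∂μ) - ∫ x, h.1 x ∂ν|

/-- The Beta(1,m) distribution on ℝ, with density m(1−x)^{m−1} on (0,1). -/
noncomputable def betaOneDist (m : ℕ) : Measure ℝ :=
  (volume : Measure ℝ).withDensity fun x =>
    ENNReal.ofReal (if 0 < x ∧ x < 1 then m * (1 - x) ^ (m - 1) else 0)

/-- `WL` has the centered equilibrium distribution with respect to `W`:
`E[f(W)] − f(0) = (1/2)·E[W²]·E[f''(WL)]` for all twice differentiable `f` such that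
`E|f(W)| < ∞` and `E|W f'(W)| < ∞` (and `f''(WL)` is integrable). -/
def IsCenteredEquilibrium {Ω : Type*} [MeasureSpace Ω] (W WL : Ω → ℝ) : Prop :=
  ∀ f : ℝ → ℝ, Differentiable ℝ f → Differentiable ℝ (deriv f) →
    Integrable (fun ω => f (W ω)) → Integrable (fun ω => W ω * deriv f (W ω)) →
    Integrable (fun ω => deriv (deriv f) (WL ω)) →
    (∫ ω, f (W ω)) - f 0 = (1 / 2) * (∫ ω, (W ω) ^ 2) * ∫ ω, deriv (deriv f) (WL ω)

lemma integral_exp_neg_abs_div {b : ℝ} (hb : 0 < b) :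
    ∫ x : ℝ, Real.exp (-|x| / b) / (2 * b) = 1 := by
  rw [integral_comp_abs (f := fun x => Real.exp (-x / b) / (2 * b)), integral_div]
  have hexp : ∀ x : ℝ, Real.exp (-x / b) = Real.exp (-b⁻¹ * x) := fun x => by
    congr 1; field_simp
  simp_rw [hexp]
  rw [integral_exp_mul_Ioi (by simpa using hb)]
  simp
  field_simp

lemma isProbabilityMeasure_laplaceDist {b : ℝ} (hb : 0 < b) :
    IsProbabilityMeasure (laplaceDist b) := by
  constructor
  rw [laplaceDist, withDensity_apply _ MeasurableSet.univ, Measure.restrict_univ,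
    ← ofReal_integral_eq_lintegral_ofReal, integral_exp_neg_abs_div hb, ENNReal.ofReal_one]
  · apply Integrable.of_integral_ne_zero
    simp [integral_exp_neg_abs_div hb]
  · exact ae_of_all _ fun x => by positivity

lemma integral_laplaceDist {b : ℝ} (hb : 0 < b) (g : ℝ → ℝ) :
    ∫ x, g x ∂(laplaceDist b) = ∫ x, Real.exp (-|x| / b) / (2 * b) * g x := by
  rw [laplaceDist, integral_withDensity_eq_integral_toReal_smul (by fun_prop)
    (ae_of_all _ fun _ => ENNReal.ofReal_lt_top)]
  congr 1 with x
  rw [ENNReal.toReal_ofReal (by positivity), smul_eq_mul]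

lemma integrable_laplaceDist_iff {b : ℝ} (hb : 0 < b) (g : ℝ → ℝ) :
    Integrable g (laplaceDist b) ↔
      Integrable fun x => Real.exp (-|x| / b) / (2 * b) * g x := by
  rw [laplaceDist, integrable_withDensity_iff_integrable_smul' (by fun_prop)
    (ae_of_all _ fun _ => ENNReal.ofReal_lt_top)]
  refine iff_of_eq ?_
  congr 1 with x
  rw [ENNReal.toReal_ofReal (by positivity), smul_eq_mul]

/-- Expectations under a translated Laplace law, split at the center of the law. -/
lemma integral_laplaceDist_comp_add {b : ℝ} (hb : 0 < b) {g : ℝ → ℝ} (x : ℝ)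
    (hg : Integrable (fun u => g (u + x)) (laplaceDist b)) :
    ∫ u, g (u + x) ∂(laplaceDist b) = 1 / (2 * b) *
      (Real.exp (x / b) * (∫ t in Ioi x, Real.exp (-t / b) * g t)
        + Real.exp (-x / b) * ∫ t in Iio x, Real.exp (t / b) * g t) := by
  have hk := ((integrable_laplaceDist_iff hb _).1 hg).comp_sub_right x
  rw [integral_laplaceDist hb, ← integral_sub_right_eq_self _ x]
  simp only [sub_add_cancel] at hk ⊢
  rw [← intervalIntegral.integral_Iic_add_Ioi (b := x) hk.integrableOn hk.integrableOn,
    integral_Iic_eq_integral_Iio, mul_add, add_comm]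
  congr 1
  · rw [← integral_const_mul, ← integral_const_mul]
    refine setIntegral_congr_fun measurableSet_Ioi fun t ht => ?_
    have ht' : x < t := ht
    have : Real.exp (-|t - x| / b) = Real.exp (x / b) * Real.exp (-t / b) := by
      rw [abs_of_pos (by linarith), ← Real.exp_add]
      congr 1; ring
    simp only [this]; ring
  · rw [← integral_const_mul, ← integral_const_mul]
    refine setIntegral_congr_fun measurableSet_Iio fun t ht => ?_
    have ht' : t < x := ht
    have : Real.exp (-|t - x| / b) = Real.exp (-x / b) * Real.exp (t / b) := by
      rw [abs_of_neg (by linarith), ← Real.exp_add]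
      congr 1; ring
    simp only [this]; ring

/-- Lemma 2.1 (Lipschitz case, non-uniform bound): if `h` is Lipschitz then the solution `f`
of the Laplace Stein equation satisfies `|f(x)| ≤ (2b + |x|)·‖h'‖`. -/
theorem laplace_stein_solution_lipschitz_pointwise
    (b : ℝ) (hb : 0 < b)
    (h : ℝ → ℝ) (L : NNReal) (hL : LipschitzWith L h)
    (hint : Integrable h (laplaceDist b))
    (htil : ℝ → ℝ) (hhtil : ∀ x, htil x = h x - ∫ z, h z ∂(laplaceDist b))
    (f : ℝ → ℝ)
    (hf : ∀ x, f x = 1 / (2 * b) *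
      (Real.exp (x / b) * (∫ t in Ioi x, Real.exp (-t / b) * htil t)
        + Real.exp (-x / b) * ∫ t in Iio x, Real.exp (t / b) * htil t)) :
    ∀ x, |f x| ≤ (2 * b + |x|) * L := by
  intro x
  have := isProbabilityMeasure_laplaceDist hb
  have hbound : ∀ u, ‖h (u + x) - h u‖ ≤ L * |x| := fun u => by
    simpa [dist_eq_norm] using hL.dist_le_mul (u + x) u
  have hdiff : Integrable (fun u => h (u + x) - h u) (laplaceDist b) := by
    refine Integrable.of_bound (C := L * |x|) ?_ (ae_of_all _ hbound)
    have hc := hL.continuous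
    exact Continuous.aestronglyMeasurable (by fun_prop)
  have hshift : Integrable (fun u => h (u + x)) (laplaceDist b) := by
    exact (hdiff.add hint).congr (ae_of_all _ fun u => sub_add_cancel _ _)
  have htil_int : Integrable (fun u => htil (u + x)) (laplaceDist b) := by
    simp only [hhtil]
    exact hshift.sub (integrable_const _)
  have hfx : f x = ∫ u, (h (u + x) - h u) ∂(laplaceDist b) := by
    rw [hf, ← integral_laplaceDist_comp_add hb x htil_int]
    simp only [hhtil]
    rw [integral_sub hshift (integrable_const _), integral_sub hshift hint]
    simp
  have hle : |f x| ≤ L * |x| := by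
    rw [hfx]
    simpa using norm_integral_le_of_norm_le_const (ae_of_all (laplaceDist b) hbound)
  nlinarith [mul_nonneg hb.le L.coe_nonneg]
end

section
/- Let b > 0, let Z ~ Laplace(0,b), let k ≥ 0 be an integer, and let h: ℝ → ℝ be (k+1)-times differentiable with E|h(Z)| < ∞ and ‖h^{(k+1)}‖_∞ < ∞. Set h̃(x) = h(x) − E[h(Z)] and define f(x) = (1/(2b))·( e^{x/b} ∫_x^∞ e^{−t/b} h̃(t) dt + e^{−x/b} ∫_{−∞}^x e^{t/b} h̃(t) dt ). Then f is (k+3)-times differentiable and ‖f^{(k+1)}‖_∞ ≤ ‖h^{(k+1)}‖_∞, ‖f^{(k+2)}‖_∞ ≤ (1/b)‖h^{(k+1)}‖_∞ and ‖f^{(k+3)}‖_∞ ≤ (2/b²)‖h^{(k+1)}‖_∞. -/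
open MeasureTheory ProbabilityTheory Real Set

/-- Growth slower than every exponential `x ↦ exp (ε * |x|)`, `ε > 0`. -/
def SubexpGrowth (g : ℝ → ℝ) : Prop :=
  ∀ ε : ℝ, 0 < ε → ∃ C : ℝ, 0 ≤ C ∧ ∀ x, |g x| ≤ C * Real.exp (ε * |x|)

/-- Convolution of `g` with the density of the Laplace(0,b) distribution. -/
noncomputable def laplaceConv (b : ℝ) (g : ℝ → ℝ) (x : ℝ) : ℝ :=
  1 / (2 * b) * ∫ u, Real.exp (-|u| / b) * g (x + u)

theorem SubexpGrowth.of_bounded {g : ℝ → ℝ} {M : ℝ} (hg : ∀ x, |g x| ≤ M) : SubexpGrowth g := by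
  intro ε hε
  have hM : 0 ≤ M := (abs_nonneg _).trans (hg 0)
  exact ⟨M, hM, fun x => (hg x).trans
    (le_mul_of_one_le_right hM (Real.one_le_exp (by positivity)))⟩

theorem SubexpGrowth.of_deriv {g : ℝ → ℝ} (hd : Differentiable ℝ g)
    (hg : SubexpGrowth (deriv g)) : SubexpGrowth g := by
  intro ε hε
  obtain ⟨C, hC, hCb⟩ := hg (ε / 2) (by positivity)
  refine ⟨|g 0| + C * (2 / ε), by positivity, fun x => ?_⟩
  have hmv : |g x - g 0| ≤ C * Real.exp (ε / 2 * |x|) * |x| := by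
    have := (convex_Icc (-|x|) |x|).norm_image_sub_le_of_norm_deriv_le (f := g) (x := 0) (y := x)
      (C := C * Real.exp (ε / 2 * |x|)) (fun y _ => hd y) (fun y hy => ?_)
      ⟨by simp, by simp⟩ ⟨neg_abs_le x, le_abs_self x⟩
    · simpa using this
    · refine (hCb y).trans ?_
      have : |y| ≤ |x| := abs_le.2 hy
      gcongr
  have hx : |x| ≤ 2 / ε * Real.exp (ε / 2 * |x|) := by
    have h1 := Real.add_one_le_exp (ε / 2 * |x|)
    calc |x| = 2 / ε * (ε / 2 * |x|) := by field_simp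
      _ ≤ _ := by gcongr; linarith
  have he : Real.exp (ε / 2 * |x|) * Real.exp (ε / 2 * |x|) = Real.exp (ε * |x|) := by
    rw [← Real.exp_add]; ring_nf
  have h1 : 1 ≤ Real.exp (ε * |x|) := Real.one_le_exp (by positivity)
  calc |g x| = |g 0 + (g x - g 0)| := by ring_nf
    _ ≤ |g 0| + |g x - g 0| := abs_add_le _ _
    _ ≤ |g 0| * Real.exp (ε * |x|)
        + C * Real.exp (ε / 2 * |x|) * (2 / ε * Real.exp (ε / 2 * |x|)) := by
        refine add_le_add (le_mul_of_one_le_right (abs_nonneg _) h1) (hmv.trans ?_)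
        gcongr
    _ = _ := by rw [← he]; ring

theorem integral_exp_neg_abs_div_s8 {c : ℝ} (hc : 0 < c) : ∫ u : ℝ, Real.exp (-|u| / c) = 2 * c := by
  rw [integral_comp_abs (f := fun u => Real.exp (-u / c))]
  have h := integral_exp_mul_Ioi (a := -1 / c) (by rw [div_neg_iff]; right; simp [hc]) 0
  have e : (fun u : ℝ => Real.exp (-u / c)) = fun u => Real.exp (-1 / c * u) := by
    ext u; congr 1; ring
  rw [e, h]
  simp

theorem integrable_exp_neg_abs_div {c : ℝ} (hc : 0 < c) :
    Integrable fun u : ℝ => Real.exp (-|u| / c) := by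
  refine Integrable.of_integral_ne_zero ?_
  rw [integral_exp_neg_abs_div_s8 hc]
  positivity

theorem integral_exp_neg_abs_div_mul_abs {c : ℝ} (hc : 0 < c) :
    ∫ u : ℝ, Real.exp (-|u| / c) * |u| = 2 * c ^ 2 := by
  rw [integral_comp_abs (f := fun u => Real.exp (-u / c) * u)]
  have h := Real.integral_rpow_mul_exp_neg_mul_Ioi (a := 2) (r := 1 / c) (by norm_num)
    (by positivity)
  have e : ∀ u : ℝ, Real.exp (-u / c) * u = u ^ ((2 : ℝ) - 1) * Real.exp (-(1 / c * u)) := by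
    intro u
    rw [show (2 : ℝ) - 1 = 1 by norm_num, Real.rpow_one, mul_comm]
    congr 2; ring
  simp_rw [e]
  rw [h]
  simp

theorem integrable_exp_neg_abs_div_mul_abs {c : ℝ} (hc : 0 < c) :
    Integrable fun u : ℝ => Real.exp (-|u| / c) * |u| := by
  refine Integrable.of_integral_ne_zero ?_
  rw [integral_exp_neg_abs_div_mul_abs hc]
  positivity

/-- The shifted values of a function of subexponential growth, weighted by the Laplace kernel,
are dominated by a Laplace kernel of twice the scale, locally uniformly in the shift. -/
theorem SubexpGrowth.exists_kernel_bound {b : ℝ} (hb : 0 < b) {g : ℝ → ℝ} (hg : SubexpGrowth g)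
    (R : ℝ) : ∃ C, ∀ x, |x| ≤ R → ∀ u,
      ‖Real.exp (-|u| / b) * g (x + u)‖ ≤ C * Real.exp (-|u| / (2 * b)) := by
  obtain ⟨C, hC, hCb⟩ := hg (1 / (2 * b)) (by positivity)
  refine ⟨C * Real.exp (1 / (2 * b) * R), fun x hx u => ?_⟩
  have h1 : |x + u| ≤ R + |u| := (abs_add_le _ _).trans (by gcongr)
  calc ‖Real.exp (-|u| / b) * g (x + u)‖ = Real.exp (-|u| / b) * |g (x + u)| := by
        rw [norm_mul, Real.norm_eq_abs, Real.abs_exp, Real.norm_eq_abs]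
    _ ≤ Real.exp (-|u| / b) * (C * Real.exp (1 / (2 * b) * (R + |u|))) := by
        gcongr
        refine (hCb _).trans ?_
        gcongr
    _ = C * (Real.exp (-|u| / b) * Real.exp (1 / (2 * b) * (R + |u|))) := by ring
    _ = C * (Real.exp (1 / (2 * b) * R) * Real.exp (-|u| / (2 * b))) := by
        rw [← Real.exp_add, ← Real.exp_add]
        congr 2
        field_simp
        ring
    _ = _ := by ring

theorem measurable_kernel_mul {b : ℝ} {g : ℝ → ℝ} (hm : Measurable g) (x : ℝ) :
    Measurable fun u : ℝ => Real.exp (-|u| / b) * g (x + u) := by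
  have : Measurable fun u : ℝ => g (x + u) := hm.comp (measurable_const_add x)
  fun_prop

theorem SubexpGrowth.integrable_kernel_mul {b : ℝ} (hb : 0 < b) {g : ℝ → ℝ}
    (hg : SubexpGrowth g) (hm : Measurable g) (x : ℝ) :
    Integrable fun u : ℝ => Real.exp (-|u| / b) * g (x + u) := by
  obtain ⟨C, hC⟩ := hg.exists_kernel_bound hb |x|
  exact ((integrable_exp_neg_abs_div (c := 2 * b) (by positivity)).const_mul C).mono'
    (measurable_kernel_mul hm x).aestronglyMeasurable (.of_forall (hC x le_rfl))

theorem hasDerivAt_laplaceConv {b : ℝ} (hb : 0 < b) {g : ℝ → ℝ} (hd : Differentiable ℝ g)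
    (hg : SubexpGrowth (deriv g)) (x : ℝ) :
    HasDerivAt (laplaceConv b g) (laplaceConv b (deriv g) x) x := by
  obtain ⟨C, hC⟩ := hg.exists_kernel_bound hb (|x| + 1)
  refine HasDerivAt.const_mul _ (hasDerivAt_integral_of_dominated_loc_of_deriv_le
    (F := fun x u => Real.exp (-|u| / b) * g (x + u))
    (F' := fun x u => Real.exp (-|u| / b) * deriv g (x + u))
    (Metric.ball_mem_nhds x one_pos) (.of_forall fun y =>
      (measurable_kernel_mul hd.continuous.measurable y).aestronglyMeasurable)
    ((hg.of_deriv hd).integrable_kernel_mul hb hd.continuous.measurable x)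
    (measurable_kernel_mul (measurable_deriv g) x).aestronglyMeasurable
    (.of_forall fun u y hy => hC y ?_ u)
    ((integrable_exp_neg_abs_div (c := 2 * b) (by positivity)).const_mul C)
    (.of_forall fun u y _ => ?_)).2
  · have h1 : |y - x| < 1 := hy
    calc |y| = |x + (y - x)| := by ring_nf
      _ ≤ |x| + |y - x| := abs_add_le _ _
      _ ≤ _ := by linarith
  · exact ((hd (y + u)).hasDerivAt.comp_add_const y u).const_mul _

theorem integrable_exp_neg_abs_sub {b : ℝ} (hb : 0 < b) {g : ℝ → ℝ}
    (hg : SubexpGrowth g) (hm : Measurable g) (x : ℝ) :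
    Integrable fun t : ℝ => Real.exp (-|t - x| / b) * g t := by
  simpa using (hg.integrable_kernel_mul hb hm x).comp_sub_right x

theorem integrableOn_Ioi_exp_neg_div_mul {b : ℝ} (hb : 0 < b) {g : ℝ → ℝ}
    (hg : SubexpGrowth g) (hm : Measurable g) (x : ℝ) :
    IntegrableOn (fun t : ℝ => Real.exp (-t / b) * g t) (Ioi x) := by
  have h := ((integrable_exp_neg_abs_sub hb hg hm x).const_mul
    (Real.exp (-x / b))).integrableOn (s := Ioi x)
  refine h.congr_fun (fun t ht => ?_) measurableSet_Ioi
  have ht' : 0 ≤ t - x := sub_nonneg.2 (le_of_lt ht)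
  simp only [abs_of_nonneg ht']
  rw [← mul_assoc, ← Real.exp_add]
  ring_nf

theorem integrableOn_Iio_exp_div_mul {b : ℝ} (hb : 0 < b) {g : ℝ → ℝ}
    (hg : SubexpGrowth g) (hm : Measurable g) (x : ℝ) :
    IntegrableOn (fun t : ℝ => Real.exp (t / b) * g t) (Iio x) := by
  have h := ((integrable_exp_neg_abs_sub hb hg hm x).const_mul
    (Real.exp (x / b))).integrableOn (s := Iio x)
  refine h.congr_fun (fun t ht => ?_) measurableSet_Iio
  have ht' : t - x ≤ 0 := sub_nonpos.2 (le_of_lt ht)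
  simp only [abs_of_nonpos ht']
  rw [← mul_assoc, ← Real.exp_add]
  ring_nf

theorem laplaceConv_eq {b : ℝ} (hb : 0 < b) {g : ℝ → ℝ} (hg : SubexpGrowth g)
    (hm : Measurable g) (x : ℝ) :
    laplaceConv b g x = 1 / (2 * b) *
      (Real.exp (x / b) * (∫ t in Ioi x, Real.exp (-t / b) * g t)
        + Real.exp (-x / b) * ∫ t in Iio x, Real.exp (t / b) * g t) := by
  unfold laplaceConv
  have hI := integrable_exp_neg_abs_sub hb hg hm x
  have h1 : ∫ u, Real.exp (-|u| / b) * g (x + u) = ∫ t, Real.exp (-|t - x| / b) * g t := by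
    rw [← integral_sub_right_eq_self (fun u => Real.exp (-|u| / b) * g (x + u)) x]
    simp
  rw [h1, ← integral_add_compl measurableSet_Ioi hI (s := Ioi x), compl_Ioi,
    integral_Iic_eq_integral_Iio, ← integral_const_mul, ← integral_const_mul]
  congr 2
  · refine setIntegral_congr_fun measurableSet_Ioi fun t ht => ?_
    have ht' : 0 ≤ t - x := sub_nonneg.2 (le_of_lt ht)
    simp only [abs_of_nonneg ht']
    rw [← mul_assoc, ← Real.exp_add]
    ring_nf
  · refine setIntegral_congr_fun measurableSet_Iio fun t ht => ?_
    have ht' : t - x ≤ 0 := sub_nonpos.2 (le_of_lt ht)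
    simp only [abs_of_nonpos ht']
    rw [← mul_assoc, ← Real.exp_add]
    ring_nf

theorem hasDerivAt_setIntegral_Ioi {φ : ℝ → ℝ} (hφ : Continuous φ)
    (hi : ∀ x, IntegrableOn φ (Ioi x)) (x : ℝ) :
    HasDerivAt (fun x => ∫ t in Ioi x, φ t) (-φ x) x := by
  have e : (fun x => ∫ t in Ioi x, φ t) = fun x => (∫ t in Ioi 0, φ t) - ∫ t in (0 : ℝ)..x, φ t := by
    ext y
    rw [← intervalIntegral.integral_Ioi_sub_Ioi' (hi 0) (hi y)]
    ring
  rw [e]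
  exact (hφ.integral_hasStrictDerivAt 0 x).hasDerivAt.const_sub _

theorem hasDerivAt_setIntegral_Iio {φ : ℝ → ℝ} (hφ : Continuous φ)
    (hi : ∀ x, IntegrableOn φ (Iio x)) (x : ℝ) :
    HasDerivAt (fun x => ∫ t in Iio x, φ t) (φ x) x := by
  have e : (fun x => ∫ t in Iio x, φ t) = fun x => (∫ t in Iio 0, φ t) + ∫ t in (0 : ℝ)..x, φ t := by
    ext y
    rw [← intervalIntegral.integral_Iio_sub_Iio' (hi y) (hi 0)]
    ring
  rw [e]
  exact (hφ.integral_hasStrictDerivAt 0 x).hasDerivAt.const_add _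

/-- `laplaceConv b g` is twice differentiable and solves `F'' = (F - g) / b ^ 2`. -/
theorem laplaceConv_ode {b : ℝ} (hb : 0 < b) {g : ℝ → ℝ} (hg : SubexpGrowth g)
    (hc : Continuous g) :
    Differentiable ℝ (laplaceConv b g) ∧ ∀ x, HasDerivAt (deriv (laplaceConv b g))
      ((laplaceConv b g x - g x) / b ^ 2) x := by
  have hb' := hb.ne'
  have hF := funext (laplaceConv_eq hb hg hc.measurable)
  have hA : ∀ x, HasDerivAt (fun x => Real.exp (x / b) * ∫ t in Ioi x, Real.exp (-t / b) * g t)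
      ((Real.exp (x / b) * ∫ t in Ioi x, Real.exp (-t / b) * g t) / b - g x) x := by
    intro x
    have h := (((hasDerivAt_id x).div_const b).exp).mul (hasDerivAt_setIntegral_Ioi
      (φ := fun t => Real.exp (-t / b) * g t) (by fun_prop)
      (integrableOn_Ioi_exp_neg_div_mul hb hg hc.measurable) x)
    refine h.congr_deriv ?_
    have : Real.exp (x / b) * Real.exp (-x / b) = 1 := by
      rw [← Real.exp_add, ← add_div]; simp
    simp only [id]
    linear_combination -(g x) * this
  have hB : ∀ x, HasDerivAt (fun x => Real.exp (-x / b) * ∫ t in Iio x, Real.exp (t / b) * g t)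
      (-(Real.exp (-x / b) * ∫ t in Iio x, Real.exp (t / b) * g t) / b + g x) x := by
    intro x
    have h := (((hasDerivAt_id x).neg.div_const b).exp).mul (hasDerivAt_setIntegral_Iio
      (φ := fun t => Real.exp (t / b) * g t) (by fun_prop)
      (integrableOn_Iio_exp_div_mul hb hg hc.measurable) x)
    refine h.congr_deriv ?_
    have : Real.exp (x / b) * Real.exp (-x / b) = 1 := by
      rw [← Real.exp_add, ← add_div]; simp
    simp only [id, Pi.neg_apply]
    linear_combination (g x) * this
  have hF1 : ∀ x, HasDerivAt (laplaceConv b g) _ x := fun x => by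
    rw [hF]
    exact ((hA x).add (hB x)).const_mul (1 / (2 * b))
  refine ⟨fun x => (hF1 x).differentiableAt, fun x => ?_⟩
  have hF' : deriv (laplaceConv b g) = fun x => 1 / (2 * b ^ 2) *
      (Real.exp (x / b) * (∫ t in Ioi x, Real.exp (-t / b) * g t)
        - Real.exp (-x / b) * ∫ t in Iio x, Real.exp (t / b) * g t) := by
    ext y
    rw [(hF1 y).deriv]
    field_simp
    ring
  rw [hF']
  refine (((hA x).sub (hB x)).const_mul (1 / (2 * b ^ 2))).congr_deriv ?_
  rw [laplaceConv_eq hb hg hc.measurable]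
  field_simp
  ring

theorem abs_laplaceConv_le {b : ℝ} (hb : 0 < b) {g : ℝ → ℝ} {M : ℝ} (hg : ∀ x, |g x| ≤ M)
    (x : ℝ) : |laplaceConv b g x| ≤ M := by
  have h := norm_integral_le_of_norm_le ((integrable_exp_neg_abs_div hb).mul_const M)
    (f := fun u => Real.exp (-|u| / b) * g (x + u)) (.of_forall fun u => by
      rw [norm_mul, Real.norm_eq_abs, Real.abs_exp, Real.norm_eq_abs]
      gcongr
      exact hg _)
  rw [integral_mul_const, integral_exp_neg_abs_div_s8 hb, Real.norm_eq_abs] at h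
  rw [laplaceConv, abs_mul, abs_of_pos (by positivity)]
  calc _ ≤ 1 / (2 * b) * (2 * b * M) := by gcongr
    _ = M := by field_simp

theorem abs_laplaceConv_sub_le {b : ℝ} (hb : 0 < b) {g : ℝ → ℝ} (hd : Differentiable ℝ g) {M : ℝ}
    (hM : ∀ x, |deriv g x| ≤ M) (x : ℝ) : |laplaceConv b g x - g x| ≤ b * M := by
  have hg := (SubexpGrowth.of_bounded hM).of_deriv hd
  have hI := hg.integrable_kernel_mul hb hd.continuous.measurable x
  have e : laplaceConv b g x - g x
      = 1 / (2 * b) * ∫ u, Real.exp (-|u| / b) * (g (x + u) - g x) := by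
    simp_rw [mul_sub]
    rw [integral_sub hI ((integrable_exp_neg_abs_div hb).mul_const _), integral_mul_const,
      integral_exp_neg_abs_div_s8 hb, laplaceConv]
    field_simp
  have h := norm_integral_le_of_norm_le ((integrable_exp_neg_abs_div_mul_abs hb).mul_const M)
    (f := fun u => Real.exp (-|u| / b) * (g (x + u) - g x)) (.of_forall fun u => by
      rw [norm_mul, Real.norm_eq_abs, Real.abs_exp, mul_assoc]
      gcongr
      have := convex_univ.norm_image_sub_le_of_norm_deriv_le (f := g) (x := x) (y := x + u)
        (fun y _ => hd y) (fun y _ => hM y) (mem_univ _) (mem_univ _)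
      rw [mul_comm]
      simpa using this)
  rw [integral_mul_const, integral_exp_neg_abs_div_mul_abs hb, Real.norm_eq_abs] at h
  rw [e, abs_mul, abs_of_pos (by positivity)]
  calc _ ≤ 1 / (2 * b) * (2 * b ^ 2 * M) := by gcongr
    _ = b * M := by field_simp

theorem subexpGrowth_iteratedDeriv {g : ℝ → ℝ} {n : ℕ}
    (hd : ∀ j < n, Differentiable ℝ (iteratedDeriv j g))
    (hn : SubexpGrowth (iteratedDeriv n g)) {j : ℕ} (hj : j ≤ n) :
    SubexpGrowth (iteratedDeriv j g) := by
  induction hj using Nat.decreasingInduction with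
  | self => exact hn
  | of_succ j hj ih => exact .of_deriv (hd j hj) (by rwa [← iteratedDeriv_succ])

theorem iteratedDeriv_laplaceConv {b : ℝ} (hb : 0 < b) {g : ℝ → ℝ} {n : ℕ}
    (hd : ∀ j < n, Differentiable ℝ (iteratedDeriv j g))
    (hn : SubexpGrowth (iteratedDeriv n g)) {j : ℕ} (hj : j ≤ n) :
    iteratedDeriv j (laplaceConv b g) = laplaceConv b (iteratedDeriv j g) := by
  induction j with
  | zero => simp
  | succ j ih =>
    rw [iteratedDeriv_succ, ih (by omega), iteratedDeriv_succ]
    refine funext fun x => (hasDerivAt_laplaceConv hb (hd j hj) ?_ x).deriv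
    rw [← iteratedDeriv_succ]
    exact subexpGrowth_iteratedDeriv hd hn hj

theorem laplaceConv_smooth {b : ℝ} (hb : 0 < b) {k : ℕ} {g : ℝ → ℝ}
    (hd : ∀ j ≤ k, Differentiable ℝ (iteratedDeriv j g)) {M : ℝ}
    (hM : ∀ x, |iteratedDeriv (k + 1) g x| ≤ M) :
    (∀ j ≤ k + 2, Differentiable ℝ (iteratedDeriv j (laplaceConv b g))) ∧
      (∀ x, |iteratedDeriv (k + 1) (laplaceConv b g) x| ≤ M) ∧
      (∀ x, |iteratedDeriv (k + 2) (laplaceConv b g) x| ≤ 1 / b * M) ∧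
      (∀ x, |iteratedDeriv (k + 3) (laplaceConv b g) x| ≤ 2 / b ^ 2 * M) := by
  have hd' : ∀ j < k + 1, Differentiable ℝ (iteratedDeriv j g) := fun j hj => hd j (by omega)
  have htop : SubexpGrowth (iteratedDeriv (k + 1) g) := .of_bounded hM
  have hgr : ∀ j ≤ k, SubexpGrowth (iteratedDeriv j g) := fun j hj =>
    subexpGrowth_iteratedDeriv hd' htop (by omega)
  have hit : ∀ j ≤ k + 1, iteratedDeriv j (laplaceConv b g) = laplaceConv b (iteratedDeriv j g) :=
    fun j hj => iteratedDeriv_laplaceConv hb hd' htop hj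
  have hode := fun j hj => laplaceConv_ode hb (hgr j hj) (hd j hj).continuous
  have h1 : iteratedDeriv (k + 1) (laplaceConv b g)
      = deriv (laplaceConv b (iteratedDeriv k g)) := by
    rw [iteratedDeriv_succ, hit k (by omega)]
  have h2 : iteratedDeriv (k + 2) (laplaceConv b g)
      = fun x => (laplaceConv b (iteratedDeriv k g) x - iteratedDeriv k g x) / b ^ 2 := by
    rw [iteratedDeriv_succ, h1]
    exact funext fun x => ((hode k le_rfl).2 x).deriv
  have h3 : ∀ x, HasDerivAt (iteratedDeriv (k + 2) (laplaceConv b g))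
      ((iteratedDeriv (k + 1) (laplaceConv b g) x - iteratedDeriv (k + 1) g x) / b ^ 2) x := by
    intro x
    rw [h2, h1, iteratedDeriv_succ]
    exact (((hode k le_rfl).1 x).hasDerivAt.sub (hd k le_rfl x).hasDerivAt).div_const _
  have hb1 : ∀ x, |iteratedDeriv (k + 1) (laplaceConv b g) x| ≤ M := by
    rw [hit (k + 1) le_rfl]
    exact abs_laplaceConv_le hb hM
  refine ⟨fun j hj => ?_, hb1, fun x => ?_, fun x => ?_⟩
  · rcases (by omega : j ≤ k ∨ j = k + 1 ∨ j = k + 2) with hj | rfl | rfl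
    · rw [hit j (by omega)]
      exact (hode j hj).1
    · rw [h1]
      exact fun x => ((hode k le_rfl).2 x).differentiableAt
    · exact fun x => (h3 x).differentiableAt
  · have h := abs_laplaceConv_sub_le hb (hd k le_rfl) (M := M)
      (by rwa [← iteratedDeriv_succ]) x
    rw [h2, abs_div, abs_of_pos (by positivity : 0 < b ^ 2)]
    calc _ ≤ b * M / b ^ 2 := by gcongr
      _ = _ := by field_simp
  · rw [iteratedDeriv_succ, (h3 x).deriv, abs_div, abs_of_pos (by positivity : 0 < b ^ 2)]
    calc _ ≤ (M + M) / b ^ 2 := by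
          gcongr
          exact (abs_sub _ _).trans (add_le_add (hb1 x) (hM x))
      _ = _ := by ring

/-- Lemma 2.1 (smooth case): if `h` is (k+1)-times differentiable with bounded (k+1)-th
derivative, then the solution `f` of the Laplace Stein equation is (k+3)-times differentiable
with `‖f^(k+1)‖ ≤ ‖h^(k+1)‖`, `‖f^(k+2)‖ ≤ ‖h^(k+1)‖/b` and `‖f^(k+3)‖ ≤ 2‖h^(k+1)‖/b²`. -/
theorem laplace_stein_solution_smooth
    (b : ℝ) (hb : 0 < b) (k : ℕ)
    (h : ℝ → ℝ)
    (hdiff : ∀ j, j ≤ k → Differentiable ℝ (iteratedDeriv j h))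
    (hint : Integrable h (laplaceDist b))
    (hbdd : BddAbove (Set.range fun x => |iteratedDeriv (k + 1) h x|))
    (htil : ℝ → ℝ) (hhtil : ∀ x, htil x = h x - ∫ z, h z ∂(laplaceDist b))
    (f : ℝ → ℝ)
    (hf : ∀ x, f x = 1 / (2 * b) *
      (Real.exp (x / b) * (∫ t in Ioi x, Real.exp (-t / b) * htil t)
        + Real.exp (-x / b) * ∫ t in Iio x, Real.exp (t / b) * htil t)) :
    (∀ j, j ≤ k + 2 → Differentiable ℝ (iteratedDeriv j f)) ∧
      (∀ x, |iteratedDeriv (k + 1) f x| ≤ ⨆ y, |iteratedDeriv (k + 1) h y|) ∧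
      (∀ x, |iteratedDeriv (k + 2) f x| ≤ 1 / b * ⨆ y, |iteratedDeriv (k + 1) h y|) ∧
      (∀ x, |iteratedDeriv (k + 3) f x| ≤ 2 / b ^ 2 * ⨆ y, |iteratedDeriv (k + 1) h y|) := by
  have hg : htil = fun x => h x - ∫ z, h z ∂(laplaceDist b) := funext hhtil
  have hsucc : ∀ j, iteratedDeriv (j + 1) htil = iteratedDeriv (j + 1) h := fun j => by
    rw [iteratedDeriv_succ', iteratedDeriv_succ', hg, deriv_sub_const_fun]
  have hd : ∀ j ≤ k, Differentiable ℝ (iteratedDeriv j htil) := by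
    rintro (_ | j) hj
    · have := hdiff 0 hj
      rw [iteratedDeriv_zero] at this ⊢
      rw [hg]
      exact this.sub_const _
    · rw [hsucc]
      exact hdiff _ hj
  have hM : ∀ x, |iteratedDeriv (k + 1) htil x| ≤ ⨆ y, |iteratedDeriv (k + 1) h y| := fun x => by
    rw [hsucc]
    exact le_ciSup hbdd x
  have hgr : SubexpGrowth htil := by
    simpa using subexpGrowth_iteratedDeriv (fun j hj => hd j (by omega))
      (.of_bounded hM) (Nat.zero_le (k + 1))
  have hm : Measurable htil := by
    have := (hd 0 (Nat.zero_le k)).continuous.measurable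
    rwa [iteratedDeriv_zero] at this
  have hfe : f = laplaceConv b htil := funext fun x => by rw [hf, laplaceConv_eq hb hgr hm]
  rw [hfe]
  exact laplaceConv_smooth hb hd hM
end

section
/- Let W be a random variable with E[W] = 0 and E[W²] = 2b² ∈ (0,∞), let W^L (defined on the same probability space) have the centered equilibrium distribution with respect to W, and let Z ~ Laplace(0,b). Then for every β > 0, d_K(W, Z) ≤ (7/2 + √10)·β/b + 3·(1 + √(2/5))·P(|W − W^L| > β). -/
open MeasureTheory ProbabilityTheory Real Set

/-- The Laplace(0,s) density. -/
noncomputable def laplacePdf (s x : ℝ) : ℝ := Real.exp (-|x| / s) / (2 * s)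

/-- The Laplace(0,s) distribution function. -/
noncomputable def laplaceCdf (s x : ℝ) : ℝ :=
  if x ≤ 0 then Real.exp (x / s) / 2 else 1 - Real.exp (-x / s) / 2

/-- An antiderivative of the Laplace(0,s) distribution function. -/
noncomputable def laplacePot (s x : ℝ) : ℝ := s ^ 2 * laplacePdf s x + max x 0

theorem hasDerivAt_of_glue {f g h : ℝ → ℝ} {d x : ℝ}
    (hg : ∀ y ≤ 0, f y = g y) (hh : ∀ y, 0 ≤ y → f y = h y)
    (hgd : x ≤ 0 → HasDerivAt g d x) (hhd : 0 ≤ x → HasDerivAt h d x) : HasDerivAt f d x := by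
  rcases lt_trichotomy x 0 with hx | hx | hx
  · refine (hgd hx.le).congr_of_eventuallyEq ?_
    filter_upwards [Iio_mem_nhds hx] with y hy using hg y (le_of_lt hy)
  · subst hx
    have h1 : HasDerivWithinAt f d (Iic 0) 0 :=
      (hgd le_rfl).hasDerivWithinAt.congr (fun y hy => hg y hy) (hg 0 le_rfl)
    have h2 : HasDerivWithinAt f d (Ici 0) 0 :=
      (hhd le_rfl).hasDerivWithinAt.congr (fun y hy => hh y hy) (hh 0 le_rfl)
    have := h1.union h2
    rwa [Iic_union_Ici, hasDerivWithinAt_univ] at this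
  · refine (hhd hx.le).congr_of_eventuallyEq ?_
    filter_upwards [Ioi_mem_nhds hx] with y hy using hh y (le_of_lt hy)

theorem laplacePdf_of_nonpos {s x : ℝ} (hx : x ≤ 0) :
    laplacePdf s x = Real.exp (x / s) / (2 * s) := by
  rw [laplacePdf, abs_of_nonpos hx, neg_neg]

theorem laplacePdf_of_nonneg {s x : ℝ} (hx : 0 ≤ x) :
    laplacePdf s x = Real.exp (-x / s) / (2 * s) := by
  rw [laplacePdf, abs_of_nonneg hx]

theorem laplaceCdf_of_nonpos {s x : ℝ} (hx : x ≤ 0) : laplaceCdf s x = Real.exp (x / s) / 2 :=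
  if_pos hx

theorem laplaceCdf_of_nonneg {s x : ℝ} (hx : 0 ≤ x) :
    laplaceCdf s x = 1 - Real.exp (-x / s) / 2 := by
  rcases hx.eq_or_lt with rfl | hx
  · norm_num [laplaceCdf]
  · exact if_neg hx.not_ge

theorem hasDerivAt_exp_div (s x : ℝ) :
    HasDerivAt (fun y => Real.exp (y / s)) (Real.exp (x / s) / s) x := by
  simpa [div_eq_mul_inv] using ((hasDerivAt_id x).div_const s).exp

theorem hasDerivAt_exp_neg_div (s x : ℝ) :
    HasDerivAt (fun y => Real.exp (-y / s)) (-(Real.exp (-x / s) / s)) x := by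
  simpa [div_eq_mul_inv] using ((hasDerivAt_id x).neg.div_const s).exp

theorem hasDerivAt_laplaceCdf {s : ℝ} (hs : 0 < s) (x : ℝ) :
    HasDerivAt (laplaceCdf s) (laplacePdf s x) x := by
  refine hasDerivAt_of_glue (fun _ => laplaceCdf_of_nonpos) (fun _ => laplaceCdf_of_nonneg)
    (fun hx => ?_) (fun hx => ?_)
  · rw [laplacePdf_of_nonpos hx]
    exact ((hasDerivAt_exp_div s x).div_const 2).congr_deriv (by field_simp)
  · rw [laplacePdf_of_nonneg hx]
    exact (((hasDerivAt_exp_neg_div s x).div_const 2).const_sub 1).congr_deriv (by field_simp)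

theorem hasDerivAt_laplacePot {s : ℝ} (hs : 0 < s) (x : ℝ) :
    HasDerivAt (laplacePot s) (laplaceCdf s x) x := by
  refine hasDerivAt_of_glue (g := fun y => s / 2 * Real.exp (y / s))
    (h := fun y => s / 2 * Real.exp (-y / s) + y) (fun y hy => ?_) (fun y hy => ?_)
    (fun hx => ?_) (fun hx => ?_)
  · rw [laplacePot, laplacePdf_of_nonpos hy, max_eq_right hy]
    field_simp
    ring
  · rw [laplacePot, laplacePdf_of_nonneg hy, max_eq_left hy]
    field_simp
  · rw [laplaceCdf_of_nonpos hx]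
    exact ((hasDerivAt_exp_div s x).const_mul (s / 2)).congr_deriv (by field_simp)
  · rw [laplaceCdf_of_nonneg hx]
    exact (((hasDerivAt_exp_neg_div s x).const_mul (s / 2)).add (hasDerivAt_id x)).congr_deriv
      (by field_simp; ring)

theorem laplacePdf_nonneg {s : ℝ} (hs : 0 < s) (x : ℝ) : 0 ≤ laplacePdf s x := by
  unfold laplacePdf
  positivity

theorem laplacePdf_le {s : ℝ} (hs : 0 < s) (x : ℝ) : laplacePdf s x ≤ 1 / (2 * s) := by
  unfold laplacePdf
  gcongr
  rw [Real.exp_le_one_iff, neg_div, neg_nonpos]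
  positivity

theorem continuous_laplacePdf (s : ℝ) : Continuous (laplacePdf s) := by
  unfold laplacePdf
  fun_prop

theorem laplaceCdf_neg (s x : ℝ) : laplaceCdf s (-x) = 1 - laplaceCdf s x := by
  rcases le_total x 0 with hx | hx
  · rw [laplaceCdf_of_nonneg (neg_nonneg.2 hx), laplaceCdf_of_nonpos hx, neg_neg]
  · rw [laplaceCdf_of_nonpos (neg_nonpos.2 hx), laplaceCdf_of_nonneg hx]
    ring

theorem laplaceCdf_nonneg {s : ℝ} (hs : 0 < s) (x : ℝ) : 0 ≤ laplaceCdf s x := by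
  rcases le_total x 0 with hx | hx
  · rw [laplaceCdf_of_nonpos hx]
    positivity
  · rw [laplaceCdf_of_nonneg hx]
    have : Real.exp (-x / s) ≤ 1 := by
      rw [Real.exp_le_one_iff, neg_div, neg_nonpos]
      positivity
    linarith

theorem laplaceCdf_le_one {s : ℝ} (hs : 0 < s) (x : ℝ) : laplaceCdf s x ≤ 1 := by
  have := laplaceCdf_nonneg hs (-x)
  rw [laplaceCdf_neg] at this
  linarith

/-- Two-sided mean value inequality for a function on `ℝ` with bounded derivative. -/
theorem sub_mem_Icc_of_hasDerivAt {f f' : ℝ → ℝ} (hf : ∀ x, HasDerivAt f (f' x) x)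
    {l u x y : ℝ} (hxy : x ≤ y) (hl : ∀ t ∈ Icc x y, l ≤ f' t) (hu : ∀ t ∈ Icc x y, f' t ≤ u) :
    f y - f x ∈ Icc (l * (y - x)) (u * (y - x)) := by
  rcases hxy.eq_or_lt with rfl | hlt
  · simp
  obtain ⟨c, hc, h⟩ := exists_hasDerivAt_eq_slope f f' hlt
    (fun t _ => (hf t).continuousAt.continuousWithinAt) (fun t _ => hf t)
  have hpos : 0 < y - x := sub_pos.2 hlt
  rw [eq_div_iff hpos.ne'] at h
  have hc' := Ioo_subset_Icc_self hc
  rw [← h]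
  exact ⟨mul_le_mul_of_nonneg_right (hl c hc') hpos.le,
    mul_le_mul_of_nonneg_right (hu c hc') hpos.le⟩

theorem abs_sub_le_of_hasDerivAt {f f' : ℝ → ℝ} (hf : ∀ x, HasDerivAt f (f' x) x)
    {C : ℝ} (hC : ∀ x, |f' x| ≤ C) (x y : ℝ) : |f y - f x| ≤ C * |y - x| := by
  have key : ∀ x y, x ≤ y → |f y - f x| ≤ C * |y - x| := fun x y hxy => by
    have := sub_mem_Icc_of_hasDerivAt hf hxy (fun t _ => (abs_le.1 (hC t)).1)
      (fun t _ => (abs_le.1 (hC t)).2)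
    rw [abs_of_nonneg (sub_nonneg.2 hxy), abs_le]
    exact ⟨by linarith [this.1], this.2⟩
  rcases le_total x y with h | h
  · exact key x y h
  · rw [abs_sub_comm, abs_sub_comm y]
    exact key y x h

theorem laplaceCdf_mono {s : ℝ} (hs : 0 < s) : Monotone (laplaceCdf s) :=
  monotone_of_hasDerivAt_nonneg (hasDerivAt_laplaceCdf hs) (laplacePdf_nonneg hs)

theorem laplaceCdf_sub_mem {s x y : ℝ} (hs : 0 < s) (hxy : x ≤ y) :
    laplaceCdf s y - laplaceCdf s x ∈ Icc 0 ((y - x) / (2 * s)) := by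
  have := sub_mem_Icc_of_hasDerivAt (hasDerivAt_laplaceCdf hs) hxy
    (fun t _ => laplacePdf_nonneg hs t) (fun t _ => laplacePdf_le hs t)
  rwa [zero_mul, one_div_mul_eq_div] at this

theorem tendsto_laplaceCdf_atBot {s : ℝ} (hs : 0 < s) :
    Filter.Tendsto (laplaceCdf s) Filter.atBot (nhds 0) := by
  have h : Filter.Tendsto (fun x => Real.exp (x / s) / 2) Filter.atBot (nhds 0) := by
    have := (Real.tendsto_exp_atBot.comp (Filter.tendsto_id.atBot_div_const hs)).div_const 2
    simpa using this
  refine h.congr' ?_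
  filter_upwards [Filter.eventually_le_atBot 0] with x hx using (laplaceCdf_of_nonpos hx).symm

theorem laplaceDist_Iic_toReal {b : ℝ} (hb : 0 < b) (z : ℝ) :
    (laplaceDist b (Iic z)).toReal = laplaceCdf b z := by
  have hint : IntegrableOn (laplacePdf b) (Iic z) :=
    integrableOn_Iic_of_intervalIntegral_norm_bounded 1 z
      (fun a => ((continuous_laplacePdf b).integrableOn_Icc).mono_set Ioc_subset_Icc_self)
      Filter.tendsto_id (Filter.Eventually.of_forall fun a => by
        simp only [Real.norm_eq_abs, abs_of_nonneg (laplacePdf_nonneg hb _), id]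
        rw [intervalIntegral.integral_eq_sub_of_hasDerivAt
          (fun x _ => hasDerivAt_laplaceCdf hb x)
          ((continuous_laplacePdf b).intervalIntegrable _ _)]
        linarith [laplaceCdf_nonneg hb a, laplaceCdf_le_one hb z])
  have h := integral_Iic_of_hasDerivAt_of_tendsto' (fun x _ => hasDerivAt_laplaceCdf hb x) hint
    (tendsto_laplaceCdf_atBot hb)
  rw [sub_zero] at h
  rw [← h, integral_eq_lintegral_of_nonneg_ae
    (Filter.Eventually.of_forall fun x => laplacePdf_nonneg hb x) hint.aestronglyMeasurable,
    laplaceDist, withDensity_apply _ measurableSet_Iic]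
  rfl

section CenteredEquilibrium

variable {Ω : Type*} [MeasureSpace Ω] [IsProbabilityMeasure (volume : Measure Ω)]
  {W WL : Ω → ℝ}

theorem integrable_of_integrable_sq (hW : Measurable W)
    (hsq : Integrable fun ω => (W ω) ^ 2) : Integrable W := by
  refine (hsq.add (integrable_const (1 : ℝ))).mono' hW.aestronglyMeasurable
    (Filter.Eventually.of_forall fun ω => ?_)
  simp only [Pi.add_apply, Real.norm_eq_abs]
  nlinarith [sq_abs (W ω), sq_nonneg (|W ω| - 1), abs_nonneg (W ω)]

/-- The defining identity for test functions with bounded first and second derivatives. -/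
theorem IsCenteredEquilibrium.identity (hCE : IsCenteredEquilibrium W WL)
    (hW : Measurable W) (hWL : Measurable WL) (hint : Integrable W)
    {f f' f'' : ℝ → ℝ} (hf : ∀ x, HasDerivAt f (f' x) x) (hf' : ∀ x, HasDerivAt f' (f'' x) x)
    {C D : ℝ} (hC : ∀ x, |f' x| ≤ C) (hD : ∀ x, |f'' x| ≤ D) :
    Integrable (fun ω => f (W ω)) ∧ Integrable (fun ω => f'' (WL ω)) ∧
      (∫ ω, f (W ω)) - f 0 = (1 / 2) * (∫ ω, (W ω) ^ 2) * ∫ ω, f'' (WL ω) := by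
  have e1 : deriv f = f' := funext fun x => (hf x).deriv
  have e2 : deriv f' = f'' := funext fun x => (hf' x).deriv
  have d1 : Differentiable ℝ f := fun x => (hf x).differentiableAt
  have d2 : Differentiable ℝ f' := fun x => (hf' x).differentiableAt
  have i1 : Integrable fun ω => f (W ω) := by
    refine ((hint.abs.const_mul C).add (integrable_const |f 0|)).mono'
      (d1.continuous.measurable.comp hW).aestronglyMeasurable
      (Filter.Eventually.of_forall fun ω => ?_)
    have h1 := abs_sub_le_of_hasDerivAt hf hC 0 (W ω)
    have h2 := abs_sub_abs_le_abs_sub (f (W ω)) (f 0)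
    rw [sub_zero] at h1
    simp only [Pi.add_apply, Real.norm_eq_abs]
    linarith
  have i2 : Integrable fun ω => W ω * f' (W ω) :=
    hint.mul_bdd (c := C) (d2.continuous.measurable.comp hW).aestronglyMeasurable
      (Filter.Eventually.of_forall fun ω => hC _)
  have m2 : Measurable f'' := e2 ▸ measurable_deriv f'
  have i3 : Integrable fun ω => f'' (WL ω) :=
    Integrable.of_bound (m2.comp hWL).aestronglyMeasurable D
      (Filter.Eventually.of_forall fun ω => hD _)
  have := hCE f d1 (e1 ▸ d2) i1 (e1 ▸ i2) (by rw [e1, e2]; exact i3)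
  rw [e1, e2] at this
  exact ⟨i1, i3, this⟩

/-- Anti-concentration of the centered equilibrium distribution. -/
theorem IsCenteredEquilibrium.integral_laplacePdf_le (hCE : IsCenteredEquilibrium W WL)
    (hW : Measurable W) (hWL : Measurable WL) {b : ℝ} (hb : 0 < b)
    (hsq : Integrable fun ω => (W ω) ^ 2)
    (hvar : ∫ ω, (W ω) ^ 2 = 2 * b ^ 2) {s : ℝ} (hs : 0 < s) (m : ℝ) :
    ∫ ω, laplacePdf s (WL ω - m) ≤ 3 / (4 * b) := by
  have hint := integrable_of_integrable_sq hW hsq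
  have hf : ∀ x, HasDerivAt (fun x => laplacePot s (x - m) - x / 2)
      (laplaceCdf s (x - m) - 1 / 2) x := fun x =>
    ((hasDerivAt_laplacePot hs _).comp_sub_const x m).sub ((hasDerivAt_id x).div_const 2)
  have hf' : ∀ x, HasDerivAt (fun x => laplaceCdf s (x - m) - 1 / 2)
      (laplacePdf s (x - m)) x := fun x =>
    ((hasDerivAt_laplaceCdf hs _).comp_sub_const x m).sub_const _
  have hC : ∀ x, |laplaceCdf s (x - m) - 1 / 2| ≤ 1 / 2 := fun x => by
    rw [abs_le]
    constructor <;> linarith [laplaceCdf_nonneg hs (x - m), laplaceCdf_le_one hs (x - m)]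
  have hD : ∀ x, |laplacePdf s (x - m)| ≤ 1 / (2 * s) := fun x => by
    rw [abs_of_nonneg (laplacePdf_nonneg hs _)]
    exact laplacePdf_le hs _
  obtain ⟨i1, -, h⟩ := hCE.identity hW hWL hint hf hf' hC hD
  have hle : (∫ ω, (laplacePot s (W ω - m) - W ω / 2)) ≤
      ∫ ω, ((1 / (4 * b)) * (W ω) ^ 2 + (b / 4 + (laplacePot s (0 - m) - 0 / 2))) := by
    refine integral_mono i1 ((hsq.const_mul _).add (integrable_const _)) fun ω => ?_
    have h1 := (le_abs_self _).trans (abs_sub_le_of_hasDerivAt hf hC 0 (W ω))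
    have h2 : |W ω| / 2 ≤ (1 / (4 * b)) * (W ω) ^ 2 + b / 4 := by
      rw [← sub_nonneg]
      have : (1 / (4 * b)) * (W ω) ^ 2 + b / 4 - |W ω| / 2 = (|W ω| - b) ^ 2 / (4 * b) := by
        rw [← sq_abs (W ω)]
        field_simp
        ring
      rw [this]
      positivity
    simp only [sub_zero] at h1 ⊢
    linarith
  rw [integral_add (hsq.const_mul _) (integrable_const _), integral_const_mul, hvar,
    integral_const] at hle
  simp only [probReal_univ, smul_eq_mul, one_mul] at hle
  rw [hvar] at h
  have h3 : b ^ 2 * ∫ ω, laplacePdf s (WL ω - m) ≤ 1 / (4 * b) * (2 * b ^ 2) + b / 4 := by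
    linarith
  have h4 : 1 / (4 * b) * (2 * b ^ 2) + b / 4 = b ^ 2 * (3 / (4 * b)) := by
    field_simp
    ring
  rw [h4] at h3
  exact le_of_mul_le_mul_left h3 (by positivity)

end CenteredEquilibrium

/-- The piecewise linear function rising from `0` at `z` to `1` at `z + α`. -/
noncomputable def ramp (z α x : ℝ) : ℝ := (max (x - z) 0 - max (x - (z + α)) 0) / α

/-- The solution of the Laplace Stein equation for the test function `ramp z α`. -/
noncomputable def rampPot (b z α x : ℝ) : ℝ :=
  (laplacePot b (x - z) - laplacePot b (x - (z + α))) / α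

theorem ramp_of_le {z α x : ℝ} (hα : 0 < α) (h : x ≤ z) : ramp z α x = 0 := by
  rw [ramp, max_eq_right (by linarith), max_eq_right (by linarith), sub_zero, zero_div]

theorem ramp_of_ge {z α x : ℝ} (hα : 0 < α) (h : z + α ≤ x) : ramp z α x = 1 := by
  rw [ramp, max_eq_left (by linarith), max_eq_left (by linarith), div_eq_one_iff_eq hα.ne']
  ring

theorem ramp_mem {z α : ℝ} (hα : 0 < α) (x : ℝ) : ramp z α x ∈ Icc 0 1 := by
  rw [ramp, mem_Icc, div_le_one hα]
  refine ⟨div_nonneg ?_ hα.le, ?_⟩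
  · exact sub_nonneg.2 (max_le_max_right 0 (by linarith))
  · rcases max_cases (x - z) 0 with h | h <;> rcases max_cases (x - (z + α)) 0 with h' | h' <;>
      linarith

theorem continuous_ramp (z α : ℝ) : Continuous (ramp z α) := by
  unfold ramp
  fun_prop

theorem abs_ramp_sub_le {z β v w : ℝ} (hβ : 0 < β) (h : |w - v| ≤ β) :
    |ramp z (β / 2) w - ramp z (β / 2) v| ≤
      Real.exp 1 * (2 * (5 * β / 4)) * laplacePdf (5 * β / 4) (v - (z + β / 4)) := by
  have hα : 0 < β / 2 := by positivity
  have hs : 0 < 5 * β / 4 := by positivity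
  have hnn := laplacePdf_nonneg hs (v - (z + β / 4))
  rw [abs_le] at h
  by_cases hv : |v - (z + β / 4)| ≤ 5 * β / 4
  · have h1 : |ramp z (β / 2) w - ramp z (β / 2) v| ≤ 1 := by
      have h1 := ramp_mem (z := z) hα w
      have h2 := ramp_mem (z := z) hα v
      rw [abs_le]
      constructor <;> linarith [h1.1, h1.2, h2.1, h2.2]
    refine h1.trans ?_
    have h2 : Real.exp 1 * (2 * (5 * β / 4)) * laplacePdf (5 * β / 4) (v - (z + β / 4)) =
        Real.exp (1 + -|v - (z + β / 4)| / (5 * β / 4)) := by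
      rw [laplacePdf, Real.exp_add]
      field_simp
    rw [h2, Real.one_le_exp_iff, neg_div, ← sub_eq_add_neg, sub_nonneg, div_le_one hs]
    exact hv
  · have h0 : ramp z (β / 2) w - ramp z (β / 2) v = 0 := by
      rcases lt_abs.1 (not_le.1 hv) with h' | h'
      · rw [ramp_of_ge hα (by linarith), ramp_of_ge hα (by linarith), sub_self]
      · rw [ramp_of_le hα (by linarith), ramp_of_le hα (by linarith), sub_self]
    rw [h0, abs_zero]
    positivity

theorem hasDerivAt_rampPot {b : ℝ} (hb : 0 < b) (z α x : ℝ) :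
    HasDerivAt (rampPot b z α) ((laplaceCdf b (x - z) - laplaceCdf b (x - (z + α))) / α) x :=
  (((hasDerivAt_laplacePot hb _).comp_sub_const x z).sub
    ((hasDerivAt_laplacePot hb _).comp_sub_const x (z + α))).div_const α

theorem rampPot_mem {b z α : ℝ} (hb : 0 < b) (hα : 0 < α) (x : ℝ) :
    rampPot b z α x ∈ Icc (laplaceCdf b (x - (z + α))) (laplaceCdf b (x - z)) := by
  have := sub_mem_Icc_of_hasDerivAt (hasDerivAt_laplacePot hb)
    (show x - (z + α) ≤ x - z by linarith)
    (fun t ht => laplaceCdf_mono hb ht.1) (fun t ht => laplaceCdf_mono hb ht.2)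
  rw [show x - z - (x - (z + α)) = α by ring] at this
  rw [rampPot, mem_Icc, le_div_iff₀ hα, div_le_iff₀ hα]
  exact this

theorem abs_rampPot_sub_le {b z α : ℝ} (hb : 0 < b) (hα : 0 < α) (x y : ℝ) :
    |rampPot b z α y - rampPot b z α x| ≤ 1 / (2 * b) * |y - x| := by
  refine abs_sub_le_of_hasDerivAt (hasDerivAt_rampPot hb z α) (fun t => ?_) x y
  have := laplaceCdf_sub_mem hb (show t - (z + α) ≤ t - z by linarith)
  rw [show t - z - (t - (z + α)) = α by ring] at this
  rw [abs_of_nonneg (div_nonneg this.1 hα.le), div_le_iff₀ hα, one_div_mul_eq_div]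
  exact this.2

theorem rampPot_stein (b z α x : ℝ) :
    b ^ 2 * ((laplacePdf b (x - z) - laplacePdf b (x - (z + α))) / α) =
      rampPot b z α x - ramp z α x := by
  simp only [rampPot, ramp, laplacePot]
  ring

section SteinBound

variable {Ω : Type*} [MeasureSpace Ω] [IsProbabilityMeasure (volume : Measure Ω)]
  {W WL : Ω → ℝ}

/-- Stein's method bound for the piecewise linear test functions. -/
theorem IsCenteredEquilibrium.abs_integral_ramp_sub_le (hCE : IsCenteredEquilibrium W WL)
    (hW : Measurable W) (hWL : Measurable WL) {b : ℝ} (hb : 0 < b)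
    (hsq : Integrable fun ω => (W ω) ^ 2) (hvar : ∫ ω, (W ω) ^ 2 = 2 * b ^ 2)
    {β : ℝ} (hβ : 0 < β) (z : ℝ) :
    |(∫ ω, ramp z (β / 2) (W ω)) - rampPot b z (β / 2) 0| ≤
      β / (2 * b) + 2 * (volume {ω | β < |W ω - WL ω|}).toReal
        + Real.exp 1 * (15 / 8) * (β / b) := by
  have hα : 0 < β / 2 := by positivity
  have hs : 0 < 5 * β / 4 := by positivity
  have hint := integrable_of_integrable_sq hW hsq
  set α := β / 2
  set B : Set Ω := {ω | β < |W ω - WL ω|}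
  have hBm : MeasurableSet B := measurableSet_lt measurable_const (hW.sub hWL).abs
  have hF01 : ∀ x, rampPot b z α x ∈ Icc 0 1 := fun x =>
    ⟨(laplaceCdf_nonneg hb _).trans (rampPot_mem hb hα x).1,
      (rampPot_mem hb hα x).2.trans (laplaceCdf_le_one hb _)⟩
  have hFc : Continuous (rampPot b z α) :=
    continuous_iff_continuousAt.2 fun x => (hasDerivAt_rampPot hb z α x).continuousAt
  have hbdd : ∀ {g : ℝ → ℝ} {X : Ω → ℝ}, Continuous g → Measurable X →
      (∀ x, g x ∈ Icc 0 1) → Integrable fun ω => g (X ω) := fun {g X} hg hX h01 =>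
    Integrable.of_bound (hg.measurable.comp hX).aestronglyMeasurable 1
      (Filter.Eventually.of_forall fun ω => by
        rw [Real.norm_eq_abs, abs_of_nonneg (h01 _).1]
        exact (h01 _).2)
  have ikW := hbdd (continuous_ramp z α) hW (ramp_mem hα)
  have ikL := hbdd (continuous_ramp z α) hWL (ramp_mem hα)
  have iFW := hbdd hFc hW hF01
  have iFL := hbdd hFc hWL hF01
  have hC : ∀ x, |(laplaceCdf b (x - z) - laplaceCdf b (x - (z + α))) / α| ≤ 1 / α := fun x => by
    rw [abs_div, abs_of_pos hα]
    gcongr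
    rw [abs_le]
    constructor <;> linarith [laplaceCdf_nonneg hb (x - z), laplaceCdf_le_one hb (x - z),
      laplaceCdf_nonneg hb (x - (z + α)), laplaceCdf_le_one hb (x - (z + α))]
  have hD : ∀ x, |(laplacePdf b (x - z) - laplacePdf b (x - (z + α))) / α| ≤
      1 / (2 * b) / α := fun x => by
    rw [abs_div, abs_of_pos hα]
    gcongr
    rw [abs_le]
    constructor <;> linarith [laplacePdf_nonneg hb (x - z), laplacePdf_le hb (x - z),
      laplacePdf_nonneg hb (x - (z + α)), laplacePdf_le hb (x - (z + α))]
  obtain ⟨-, -, hid⟩ := hCE.identity hW hWL hint (hasDerivAt_rampPot hb z α)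
    (fun x => (((hasDerivAt_laplaceCdf hb _).comp_sub_const x z).sub
      ((hasDerivAt_laplaceCdf hb _).comp_sub_const x (z + α))).div_const α) hC hD
  rw [hvar, show (1 / 2 : ℝ) * (2 * b ^ 2) = b ^ 2 by ring, ← integral_const_mul] at hid
  simp only [rampPot_stein] at hid
  rw [integral_sub iFL ikL] at hid
  have hexpr : (∫ ω, ramp z α (W ω)) - rampPot b z α 0 =
      ∫ ω, ((ramp z α (W ω) - ramp z α (WL ω)) +
        (rampPot b z α (WL ω) - rampPot b z α (W ω))) := by
    rw [integral_add (by exact ikW.sub ikL) (by exact iFL.sub iFW), integral_sub ikW ikL, integral_sub iFL iFW]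
    linarith
  have ipdf : Integrable fun ω => laplacePdf (5 * β / 4) (WL ω - (z + β / 4)) :=
    Integrable.of_bound ((continuous_laplacePdf _).measurable.comp
      (hWL.sub_const _)).aestronglyMeasurable (1 / (2 * (5 * β / 4)))
      (Filter.Eventually.of_forall fun ω => by
        rw [Real.norm_eq_abs, abs_of_nonneg (laplacePdf_nonneg hs _)]
        exact laplacePdf_le hs _)
  have iB : Integrable (B.indicator fun _ => (2 : ℝ)) := (integrable_const _).indicator hBm
  have hpt : ∀ ω, ‖(ramp z α (W ω) - ramp z α (WL ω)) +
        (rampPot b z α (WL ω) - rampPot b z α (W ω))‖ ≤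
      (β / (2 * b) + B.indicator (fun _ => (2 : ℝ)) ω) + Real.exp 1 * (2 * (5 * β / 4)) *
        laplacePdf (5 * β / 4) (WL ω - (z + β / 4)) := fun ω => by
    have hnn : 0 ≤ Real.exp 1 * (2 * (5 * β / 4)) *
        laplacePdf (5 * β / 4) (WL ω - (z + β / 4)) := by
      have := laplacePdf_nonneg hs (WL ω - (z + β / 4))
      positivity
    have hβb : 0 ≤ β / (2 * b) := by positivity
    by_cases hω : ω ∈ B
    · rw [indicator_of_mem hω, Real.norm_eq_abs, abs_le]
      have h1 := ramp_mem (z := z) hα (W ω)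
      have h2 := ramp_mem (z := z) hα (WL ω)
      have h3 := hF01 (W ω)
      have h4 := hF01 (WL ω)
      constructor <;> linarith [h1.1, h1.2, h2.1, h2.2, h3.1, h3.2, h4.1, h4.2]
    · rw [indicator_of_notMem hω, add_zero]
      have hle : |W ω - WL ω| ≤ β := not_lt.1 hω
      have h1 := abs_ramp_sub_le (z := z) hβ hle
      have h2 := abs_rampPot_sub_le (z := z) hb hα (W ω) (WL ω)
      rw [abs_sub_comm (WL ω)] at h2
      have h3 : 1 / (2 * b) * |W ω - WL ω| ≤ β / (2 * b) := by
        rw [one_div_mul_eq_div]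
        gcongr
      refine (norm_add_le _ _).trans ?_
      rw [Real.norm_eq_abs, Real.norm_eq_abs]
      linarith
  have hmain := norm_integral_le_of_norm_le (((integrable_const _).add iB).add
    (ipdf.const_mul _)) (Filter.Eventually.of_forall hpt)
  rw [← hexpr, Real.norm_eq_abs] at hmain
  refine hmain.trans ?_
  have hpdf := hCE.integral_laplacePdf_le hW hWL hb hsq hvar hs (z + β / 4)
  have e1 : ∫ ω, ((β / (2 * b) + B.indicator (fun _ => (2 : ℝ)) ω) +
      Real.exp 1 * (2 * (5 * β / 4)) * laplacePdf (5 * β / 4) (WL ω - (z + β / 4))) =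
      β / (2 * b) + 2 * (volume B).toReal + Real.exp 1 * (2 * (5 * β / 4)) *
        ∫ ω, laplacePdf (5 * β / 4) (WL ω - (z + β / 4)) := by
    rw [integral_add (by exact (integrable_const _).add iB) (ipdf.const_mul _),
      integral_add (integrable_const _) iB, integral_const_mul, integral_indicator_const _ hBm,
      integral_const]
    simp [Measure.real, mul_comm]
  refine e1.le.trans ?_
  refine (add_le_add_iff_left _).2 ?_
  calc Real.exp 1 * (2 * (5 * β / 4)) * ∫ ω, laplacePdf (5 * β / 4) (WL ω - (z + β / 4))
      ≤ Real.exp 1 * (2 * (5 * β / 4)) * (3 / (4 * b)) := by gcongr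
    _ = Real.exp 1 * (15 / 8) * (β / b) := by
      field_simp
      ring

end SteinBound

theorem rampPot_zero_mem {b z α : ℝ} (hb : 0 < b) (hα : 0 < α) :
    rampPot b z α 0 ∈ Icc (1 - laplaceCdf b (z + α)) (1 - laplaceCdf b z) := by
  have := rampPot_mem (z := z) hb hα 0
  rw [zero_sub, zero_sub, laplaceCdf_neg, laplaceCdf_neg] at this
  exact this

/-- Theorem 2.4: Laplace approximation bounds via the centered equilibrium distribution. -/
theorem centered_equilibrium_kolmogorov_W
    {Ω : Type*} [MeasureSpace Ω] [IsProbabilityMeasure (volume : Measure Ω)]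
    (W WL : Ω → ℝ) (hWmeas : Measurable W) (hWLmeas : Measurable WL)
    (b : ℝ) (hb : 0 < b)
    (hWmean : ∫ ω, W ω = 0)
    (hWsqInt : Integrable fun ω => (W ω) ^ 2)
    (hWvar : ∫ ω, (W ω) ^ 2 = 2 * b ^ 2)
    (hCE : IsCenteredEquilibrium W WL)
    (β : ℝ) (hβ : 0 < β) :
    kolDist (Measure.map W volume) (laplaceDist b) ≤
      (7 / 2 + Real.sqrt 10) * β / b
        + 3 * (1 + Real.sqrt (2 / 5)) * (volume {ω | β < |W ω - WL ω|}).toReal := by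
  set S := (7 / 2 + Real.sqrt 10) * β / b
    + 3 * (1 + Real.sqrt (2 / 5)) * (volume {ω | β < |W ω - WL ω|}).toReal with hS
  have hα : 0 < β / 2 := by positivity
  have hbudget : β / (2 * b) + 2 * (volume {ω | β < |W ω - WL ω|}).toReal
      + Real.exp 1 * (15 / 8) * (β / b) + β / 2 / (2 * b) ≤ S := by
    have h10 : (3 : ℝ) ≤ Real.sqrt 10 := Real.le_sqrt_of_sq_le (by norm_num)
    have he := Real.exp_one_lt_d9
    have hr : 0 ≤ β / b := by positivity
    have h1 : (1 / 2 + Real.exp 1 * (15 / 8) + 1 / 4) * (β / b) ≤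
        (7 / 2 + Real.sqrt 10) * (β / b) :=
      mul_le_mul_of_nonneg_right (by linarith) hr
    have h2 : (2 : ℝ) * (volume {ω | β < |W ω - WL ω|}).toReal ≤
        3 * (1 + Real.sqrt (2 / 5)) * (volume {ω | β < |W ω - WL ω|}).toReal := by
      gcongr
      linarith [Real.sqrt_nonneg (2 / 5 : ℝ)]
    have e1 : (1 / 2 + Real.exp 1 * (15 / 8) + 1 / 4) * (β / b) =
        β / (2 * b) + Real.exp 1 * (15 / 8) * (β / b) + β / 2 / (2 * b) := by
      field_simp
      ring
    rw [hS, mul_div_assoc]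
    linarith
  refine ciSup_le fun z => ?_
  have hcdf : ((Measure.map W volume) (Iic z)).toReal = 1 - ∫ ω, (W ⁻¹' Ioi z).indicator 1 ω := by
    have hm : MeasurableSet (W ⁻¹' Ioi z) := hWmeas measurableSet_Ioi
    rw [integral_indicator_one hm, Measure.map_apply hWmeas measurableSet_Iic,
      ← compl_Ioi, preimage_compl, ← Measure.real, probReal_compl_eq_one_sub hm]
  have hiI : Integrable ((W ⁻¹' Ioi z).indicator (1 : Ω → ℝ)) :=
    (integrable_const (1 : ℝ)).indicator (hWmeas measurableSet_Ioi)
  have hiR : ∀ y, Integrable fun ω => ramp y (β / 2) (W ω) := fun y =>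
    Integrable.of_bound ((continuous_ramp y _).measurable.comp hWmeas).aestronglyMeasurable 1
      (Filter.Eventually.of_forall fun ω => by
        rw [Real.norm_eq_abs, abs_of_nonneg (ramp_mem hα _).1]
        exact (ramp_mem hα _).2)
  rw [hcdf, laplaceDist_Iic_toReal hb]
  have hlow : ∫ ω, ramp z (β / 2) (W ω) ≤ ∫ ω, (W ⁻¹' Ioi z).indicator (1 : Ω → ℝ) ω := by
    refine integral_mono (hiR z) hiI fun ω => ?_
    by_cases h : z < W ω
    · rw [indicator_of_mem (show ω ∈ W ⁻¹' Ioi z from h)]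
      exact (ramp_mem hα _).2
    · rw [indicator_of_notMem (show ω ∉ W ⁻¹' Ioi z from h)]
      exact (ramp_of_le hα (not_lt.1 h)).le
  have hupp : ∫ ω, (W ⁻¹' Ioi z).indicator (1 : Ω → ℝ) ω ≤
      ∫ ω, ramp (z - β / 2) (β / 2) (W ω) := by
    refine integral_mono hiI (hiR _) fun ω => ?_
    by_cases h : z < W ω
    · rw [indicator_of_mem (show ω ∈ W ⁻¹' Ioi z from h)]
      exact (ramp_of_ge hα (by linarith)).ge
    · rw [indicator_of_notMem (show ω ∉ W ⁻¹' Ioi z from h)]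
      exact (ramp_mem hα _).1
  have h1 := abs_le.1 (hCE.abs_integral_ramp_sub_le hWmeas hWLmeas hb hWsqInt hWvar hβ z)
  have h2 := abs_le.1
    (hCE.abs_integral_ramp_sub_le hWmeas hWLmeas hb hWsqInt hWvar hβ (z - β / 2))
  have h3 := rampPot_zero_mem (z := z) hb hα
  have h4 := rampPot_zero_mem (z := z - β / 2) hb hα
  have h5 := laplaceCdf_sub_mem hb (show z ≤ z + β / 2 by linarith)
  have h6 := laplaceCdf_sub_mem hb (show z - β / 2 ≤ z by linarith)
  rw [add_sub_cancel_left] at h5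
  rw [sub_sub_cancel] at h6
  rw [abs_le]
  constructor
  · linarith [h2.2, h4.2, h6.2]
  · linarith [h1.1, h3.1, h5.2]
end

section
/- Let W be a random variable with E[W] = 0, E[W²] = 2b² ∈ (0,∞) and E[|W|³] < ∞, let W^L (defined on the same probability space) have the centered equilibrium distribution with respect to W, and let Z ~ Laplace(0,b). Then d_W(W^L, Z) ≤ E|W − W^L| and d_K(W^L, Z) ≤ (1/b)·E|W − W^L|. -/
open MeasureTheory ProbabilityTheory Real Set

lemma exp_neg_abs_div_integrable {b : ℝ} (hb : 0 < b) :
    Integrable fun x : ℝ => Real.exp (-|x| / b) := by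
  have hb' : 0 < b⁻¹ := inv_pos.2 hb
  rw [← integrableOn_univ, ← Iic_union_Ioi (a := (0 : ℝ))]
  refine IntegrableOn.union ?_ ?_
  · refine (integrableOn_exp_mul_Iic hb' 0).congr_fun (fun x hx => ?_) measurableSet_Iic
    simp only [abs_of_nonpos (mem_Iic.1 hx)]
    congr 1
    ring
  · refine (integrableOn_exp_mul_Ioi (neg_lt_zero.2 hb') 0).congr_fun (fun x hx => ?_)
      measurableSet_Ioi
    simp only [abs_of_pos (mem_Ioi.1 hx)]
    congr 1
    ring

lemma charFun_laplaceDist {b : ℝ} (hb : 0 < b) (t : ℝ) :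
    charFun (laplaceDist b) t = (1 + b ^ 2 * t ^ 2 : ℂ)⁻¹ := by
  have hbC : (b : ℂ) ≠ 0 := by exact_mod_cast hb.ne'
  have hplus : 0 < ((b : ℂ)⁻¹ + t * Complex.I).re := by simpa using hb
  have hminus : (-(b : ℂ)⁻¹ + t * Complex.I).re < 0 := by simpa using hb
  have hdens : Measurable fun x : ℝ => ENNReal.ofReal (Real.exp (-|x| / b) / (2 * b)) := by
    fun_prop
  rw [charFun_apply_real, laplaceDist, integral_withDensity_eq_integral_toReal_smul hdens
    (by simp)]
  have htoReal (x : ℝ) : (ENNReal.ofReal (Real.exp (-|x| / b) / (2 * b))).toReal =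
      Real.exp (-|x| / b) / (2 * b) := ENNReal.toReal_ofReal (by positivity)
  simp_rw [htoReal]
  have hint : Integrable fun x : ℝ => (Real.exp (-|x| / b) / (2 * b)) •
      Complex.exp (t * x * Complex.I) := by
    refine ((exp_neg_abs_div_integrable hb).div_const (2 * b)).mono'
      (by fun_prop) (.of_forall fun x => ?_)
    rw [norm_smul, ← Complex.ofReal_mul,
      Complex.norm_exp_ofReal_mul_I, mul_one, Real.norm_of_nonneg (by positivity)]
  rw [← intervalIntegral.integral_Iic_add_Ioi (b := 0) hint.integrableOn hint.integrableOn]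
  have hneg : ∫ x : ℝ in Iic 0, (Real.exp (-|x| / b) / (2 * b)) •
      Complex.exp (t * x * Complex.I) = ((b : ℂ)⁻¹ + t * Complex.I)⁻¹ / (2 * b) := by
    rw [← one_div, ← Complex.exp_zero, ← mul_zero ((b : ℂ)⁻¹ + t * Complex.I),
      ← Complex.ofReal_zero, ← integral_exp_mul_complex_Iic hplus, ← integral_div]
    refine setIntegral_congr_fun measurableSet_Iic fun x hx => ?_
    simp only [abs_of_nonpos (mem_Iic.1 hx), Complex.real_smul, Complex.ofReal_div,
      Complex.ofReal_exp]
    rw [div_mul_eq_mul_div, ← Complex.exp_add]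
    push_cast
    congr 2
    field_simp
  have hpos : ∫ x : ℝ in Ioi 0, (Real.exp (-|x| / b) / (2 * b)) •
      Complex.exp (t * x * Complex.I) = -(-(b : ℂ)⁻¹ + t * Complex.I)⁻¹ / (2 * b) := by
    rw [← one_div, ← neg_div, ← Complex.exp_zero, ← mul_zero (-(b : ℂ)⁻¹ + t * Complex.I),
      ← Complex.ofReal_zero, ← integral_exp_mul_complex_Ioi hminus, ← integral_div]
    refine setIntegral_congr_fun measurableSet_Ioi fun x hx => ?_
    simp only [abs_of_pos (mem_Ioi.1 hx), Complex.real_smul, Complex.ofReal_div,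
      Complex.ofReal_exp]
    rw [div_mul_eq_mul_div, ← Complex.exp_add]
    push_cast
    congr 2
    field_simp
  rw [hneg, hpos]
  have h1 : (b : ℂ)⁻¹ + t * Complex.I ≠ 0 := fun h => by simp [h] at hplus
  have h2 : -(b : ℂ)⁻¹ + t * Complex.I ≠ 0 := fun h => by simp [h] at hminus
  have h3 : (1 + b ^ 2 * t ^ 2 : ℂ) ≠ 0 := by
    have : (1 + b ^ 2 * t ^ 2 : ℝ) ≠ 0 := by positivity
    exact_mod_cast this
  have h4 : (1 + b * t * Complex.I : ℂ) ≠ 0 := by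
    contrapose! h1
    field_simp
    linear_combination h1
  have h5 : (-1 + b * t * Complex.I : ℂ) ≠ 0 := by
    contrapose! h2
    field_simp
    linear_combination h2
  rw [show (b : ℂ)⁻¹ + t * Complex.I = (1 + b * t * Complex.I) / b by field_simp,
    show -(b : ℂ)⁻¹ + t * Complex.I = (-1 + b * t * Complex.I) / b by field_simp]
  field_simp
  linear_combination (-2 * (b : ℂ) ^ 2 * t ^ 2) * Complex.I_sq

lemma integrable_id_laplaceDist {b : ℝ} (hb : 0 < b) :
    Integrable (fun x : ℝ => x) (laplaceDist b) := by
  have hdens : Measurable fun x : ℝ => ENNReal.ofReal (Real.exp (-|x| / b) / (2 * b)) := by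
    fun_prop
  rw [laplaceDist, integrable_withDensity_iff_integrable_smul' hdens (by simp)]
  refine (exp_neg_abs_div_integrable (b := 2 * b) (by positivity)).mono'
    (by fun_prop) (.of_forall fun x => ?_)
  rw [ENNReal.toReal_ofReal (by positivity), norm_smul, Real.norm_of_nonneg (by positivity),
    Real.norm_eq_abs]
  have hle : |x| / (2 * b) ≤ Real.exp (|x| / (2 * b)) := by
    linarith [Real.add_one_le_exp (|x| / (2 * b))]
  have hsplit : Real.exp (-|x| / b) =
      Real.exp (-|x| / (2 * b)) * Real.exp (-(|x| / (2 * b))) := by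
    rw [← Real.exp_add]
    congr 1
    field_simp
    ring
  calc Real.exp (-|x| / b) / (2 * b) * |x|
      = Real.exp (-|x| / (2 * b)) * (Real.exp (-(|x| / (2 * b))) * (|x| / (2 * b))) := by
        rw [hsplit]; ring
    _ ≤ Real.exp (-|x| / (2 * b)) * (Real.exp (-(|x| / (2 * b))) * Real.exp (|x| / (2 * b))) := by
        gcongr
    _ = Real.exp (-|x| / (2 * b)) := by
        rw [← Real.exp_add, neg_add_cancel, Real.exp_zero, mul_one]

lemma laplaceDist_le_volume {b : ℝ} (hb : 0 < b) (s : Set ℝ) (hs : MeasurableSet s) :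
    laplaceDist b s ≤ ENNReal.ofReal (1 / (2 * b)) * volume s := by
  rw [laplaceDist, withDensity_apply _ hs, ← setLIntegral_const]
  refine lintegral_mono fun x => ENNReal.ofReal_le_ofReal ?_
  gcongr
  exact Real.exp_le_one_iff.2 (div_nonpos_of_nonpos_of_nonneg (by simp) hb.le)

lemma abs_laplaceDist_Iic_sub_le {b : ℝ} (hb : 0 < b) (x y : ℝ) :
    |(laplaceDist b).real (Iic x) - (laplaceDist b).real (Iic y)| ≤ 1 / b * |x - y| := by
  have := isProbabilityMeasure_laplaceDist hb
  wlog hxy : y ≤ x generalizing x y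
  · rw [abs_sub_comm, abs_sub_comm x]
    exact this y x (le_of_not_ge hxy)
  rw [← measureReal_sdiff (Iic_subset_Iic.2 hxy) measurableSet_Iic, Iic_sdiff_Iic,
    abs_of_nonneg measureReal_nonneg, abs_of_nonneg (sub_nonneg.2 hxy)]
  refine ENNReal.toReal_le_of_le_ofReal (by have := sub_nonneg.2 hxy; positivity) ?_
  refine (laplaceDist_le_volume hb _ measurableSet_Ioc).trans ?_
  rw [Real.volume_Ioc, ← ENNReal.ofReal_mul (by positivity)]
  refine ENNReal.ofReal_le_ofReal ?_
  have := sub_nonneg.2 hxy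
  gcongr
  linarith

lemma integrable_of_integrable_sq_s12 {Ω : Type*} [MeasureSpace Ω]
    [IsProbabilityMeasure (volume : Measure Ω)] {W : Ω → ℝ} (hW : Measurable W)
    (hW2 : Integrable fun ω => (W ω) ^ 2) : Integrable W :=
  ((memLp_two_iff_integrable_sq hW.aestronglyMeasurable).2 hW2).integrable one_le_two

lemma charFun_map_eq_cos_add_sin {Ω : Type*} [MeasureSpace Ω]
    [IsProbabilityMeasure (volume : Measure Ω)] {X : Ω → ℝ} (hX : Measurable X) (t : ℝ) :
    charFun (Measure.map X volume) t =
      (∫ ω, Real.cos (t * X ω) : ℝ) + (∫ ω, Real.sin (t * X ω) : ℝ) * Complex.I := by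
  have hcos : Integrable fun ω => ((Real.cos (t * X ω) : ℝ) : ℂ) :=
    .of_bound (by fun_prop) 1 (.of_forall fun ω => by
      rw [Complex.norm_real]
      exact Real.abs_cos_le_one _)
  have hsin : Integrable fun ω => ((Real.sin (t * X ω) : ℝ) : ℂ) :=
    .of_bound (by fun_prop) 1 (.of_forall fun ω => by
      rw [Complex.norm_real]
      exact Real.abs_sin_le_one _)
  rw [charFun_apply_real, integral_map hX.aemeasurable (by fun_prop), ← integral_complex_ofReal,
    ← integral_complex_ofReal, ← integral_mul_const, ← integral_add hcos (hsin.mul_const _)]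
  refine integral_congr_ae (.of_forall fun ω => ?_)
  simp [Complex.exp_mul_I]

lemma one_sub_charFun_map_eq {Ω : Type*} [MeasureSpace Ω]
    [IsProbabilityMeasure (volume : Measure Ω)] {W WL : Ω → ℝ} (hW : Measurable W)
    (hWL : Measurable WL) (hW2 : Integrable fun ω => (W ω) ^ 2)
    (hCE : IsCenteredEquilibrium W WL) (t : ℝ) :
    1 - charFun (Measure.map W volume) t =
      ((1 / 2 * (∫ ω, (W ω) ^ 2) : ℝ) : ℂ) * t ^ 2 * charFun (Measure.map WL volume) t := by
  have hW1 := integrable_of_integrable_sq_s12 hW hW2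
  have hdcos : deriv (fun x : ℝ => Real.cos (t * x)) = fun x => -t * Real.sin (t * x) := by
    ext x
    have := ((hasDerivAt_id x).const_mul t).cos.deriv
    simp only [id_eq] at this
    rw [this]
    ring
  have hddcos : deriv (fun x : ℝ => -t * Real.sin (t * x)) =
      fun x => -t ^ 2 * Real.cos (t * x) := by
    ext x
    have := (((hasDerivAt_id x).const_mul t).sin.const_mul (-t)).deriv
    simp only [id_eq] at this
    rw [this]
    ring
  have hdsin : deriv (fun x : ℝ => Real.sin (t * x)) = fun x => t * Real.cos (t * x) := by
    ext x
    have := ((hasDerivAt_id x).const_mul t).sin.deriv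
    simp only [id_eq] at this
    rw [this]
    ring
  have hddsin : deriv (fun x : ℝ => t * Real.cos (t * x)) =
      fun x => -t ^ 2 * Real.sin (t * x) := by
    ext x
    have := (((hasDerivAt_id x).const_mul t).cos.const_mul t).deriv
    simp only [id_eq] at this
    rw [this]
    ring
  have intcos (X : Ω → ℝ) (hX : Measurable X) : Integrable fun ω => Real.cos (t * X ω) :=
    .of_bound (by fun_prop) 1 (.of_forall fun ω => Real.abs_cos_le_one _)
  have intsin (X : Ω → ℝ) (hX : Measurable X) : Integrable fun ω => Real.sin (t * X ω) :=
    .of_bound (by fun_prop) 1 (.of_forall fun ω => Real.abs_sin_le_one _)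
  have ecos := hCE (fun x => Real.cos (t * x)) (by fun_prop) (by rw [hdcos]; fun_prop)
    (intcos W hW)
    (by
      rw [hdcos]
      refine hW1.mul_bdd (c := |t|) (by fun_prop) (.of_forall fun ω => ?_)
      rw [norm_mul, norm_neg]
      exact mul_le_of_le_one_right (norm_nonneg _) (Real.abs_sin_le_one _))
    (by
      rw [hdcos, hddcos]
      exact (intcos WL hWL).const_mul _)
  have esin := hCE (fun x => Real.sin (t * x)) (by fun_prop) (by rw [hdsin]; fun_prop)
    (intsin W hW)
    (by
      rw [hdsin]
      refine hW1.mul_bdd (c := |t|) (by fun_prop) (.of_forall fun ω => ?_)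
      rw [norm_mul]
      exact mul_le_of_le_one_right (norm_nonneg _) (Real.abs_cos_le_one _))
    (by
      rw [hdsin, hddsin]
      exact (intsin WL hWL).const_mul _)
  simp only [hdcos, hddcos, hdsin, hddsin, mul_zero, Real.cos_zero, Real.sin_zero, sub_zero,
    integral_const_mul] at ecos esin
  rw [charFun_map_eq_cos_add_sin hW, charFun_map_eq_cos_add_sin hWL, esin,
    sub_eq_iff_eq_add.1 ecos]
  push_cast
  ring

/-- If `Z ~ Laplace(0,b)` is independent of `(W, WL)`, then the mixture of `WL` and `W + Z` has
the same law as the mixture of `WL + Z` and `Z`. -/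
lemma map_add_conv_laplaceDist {Ω : Type*} [MeasureSpace Ω]
    [IsProbabilityMeasure (volume : Measure Ω)] {W WL : Ω → ℝ} (hW : Measurable W)
    (hWL : Measurable WL) {b : ℝ} (hb : 0 < b) (hW2 : Integrable fun ω => (W ω) ^ 2)
    (hvar : ∫ ω, (W ω) ^ 2 = 2 * b ^ 2) (hCE : IsCenteredEquilibrium W WL) :
    Measure.map WL volume + (Measure.map W volume).conv (laplaceDist b) =
      (Measure.map WL volume).conv (laplaceDist b) + laplaceDist b := by
  have := isProbabilityMeasure_laplaceDist hb
  have := Measure.isProbabilityMeasure_map (μ := (volume : Measure Ω)) hW.aemeasurable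
  have := Measure.isProbabilityMeasure_map (μ := (volume : Measure Ω)) hWL.aemeasurable
  have charFun_add (μ ν : Measure ℝ) [IsFiniteMeasure μ] [IsFiniteMeasure ν] (t : ℝ) :
      charFun (μ + ν) t = charFun μ t + charFun ν t := by
    have hint (ρ : Measure ℝ) [IsFiniteMeasure ρ] :
        Integrable (fun x : ℝ => Complex.exp (t * x * Complex.I)) ρ := by
      refine .of_bound (by fun_prop) 1 (.of_forall fun x => ?_)
      rw [← Complex.ofReal_mul, Complex.norm_exp_ofReal_mul_I]
    simp only [charFun_apply_real]
    exact integral_add_measure (hint μ) (hint ν)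
  refine Measure.ext_of_charFun (funext fun t => ?_)
  have h := one_sub_charFun_map_eq hW hWL hW2 hCE t
  rw [hvar] at h
  push_cast at h
  have h0 : (1 + b ^ 2 * t ^ 2 : ℂ) ≠ 0 := by
    have : (1 + b ^ 2 * t ^ 2 : ℝ) ≠ 0 := by positivity
    exact_mod_cast this
  rw [charFun_add, charFun_add, charFun_conv, charFun_conv, charFun_laplaceDist hb]
  field_simp
  linear_combination -h

/-- Testing against the second antiderivative of `min |x| n` shows that the equilibrium variable
inherits a first moment from the third moment of `W`. -/
lemma IsCenteredEquilibrium.integrable {Ω : Type*} [MeasureSpace Ω]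
    [IsProbabilityMeasure (volume : Measure Ω)] {W WL : Ω → ℝ} (hW : Measurable W)
    (hWL : Measurable WL) (hvar : 0 < ∫ ω, (W ω) ^ 2)
    (hCE : IsCenteredEquilibrium W WL) (hW3 : Integrable fun ω => |W ω| ^ 3) :
    Integrable WL := by
  set v := 1 / 2 * ∫ ω, (W ω) ^ 2 with hv
  have hvpos : 0 < v := by positivity
  have hint (n : ℕ) : Integrable fun ω => min |WL ω| (n : ℝ) :=
    .of_bound (by fun_prop) n (.of_forall fun ω => by
      rw [Real.norm_of_nonneg (le_min (abs_nonneg _) n.cast_nonneg)]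
      exact min_le_right _ _)
  have hbound (n : ℕ) : ∫ ω, min |WL ω| (n : ℝ) ≤ (∫ ω, |W ω| ^ 3) / v := by
    have hg : Continuous fun x : ℝ => min |x| (n : ℝ) := by fun_prop
    let F : ℝ → ℝ := fun x => ∫ u in 0..x, min |u| (n : ℝ)
    have hF (x : ℝ) : HasDerivAt F (min |x| (n : ℝ)) x := hg.integral_hasStrictDerivAt 0 x
      |>.hasDerivAt
    have hFc : Continuous F := continuous_iff_continuousAt.2 fun x => (hF x).continuousAt
    let G : ℝ → ℝ := fun x => ∫ u in 0..x, F u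
    have hG (x : ℝ) : HasDerivAt G (F x) x := hFc.integral_hasStrictDerivAt 0 x |>.hasDerivAt
    have hGc : Continuous G := continuous_iff_continuousAt.2 fun x => (hG x).continuousAt
    have abs_le_of_mem {u x : ℝ} (hu : u ∈ Set.uIoc 0 x) : |u| ≤ |x| := by
      simpa using Set.abs_sub_left_of_mem_uIcc (uIoc_subset_uIcc hu)
    have hFle (x : ℝ) : |F x| ≤ |x| * |x| := by
      have := intervalIntegral.norm_integral_le_of_norm_le_const (a := 0) (b := x) (C := |x|)
        (f := fun u => min |u| (n : ℝ)) fun u hu => by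
          rw [Real.norm_of_nonneg (le_min (abs_nonneg _) n.cast_nonneg)]
          exact (min_le_left _ _).trans (abs_le_of_mem hu)
      simpa using this
    have hGle (x : ℝ) : |G x| ≤ |x| ^ 3 := by
      have := intervalIntegral.norm_integral_le_of_norm_le_const (a := 0) (b := x)
        (C := |x| * |x|) (f := F) fun u hu => (hFle u).trans
          (mul_self_le_mul_self (abs_nonneg _) (abs_le_of_mem hu))
      rw [sub_zero] at this
      exact this.trans_eq (by ring)
    have hdG : deriv G = F := funext fun x => (hG x).deriv
    have hdF : deriv F = fun x => min |x| (n : ℝ) := funext fun x => (hF x).deriv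
    have hGW : Integrable fun ω => G (W ω) :=
      hW3.mono' (hGc.measurable.comp hW).aestronglyMeasurable (.of_forall fun ω => hGle _)
    have h := hCE G (fun x => (hG x).differentiableAt)
      (hdG ▸ fun x => (hF x).differentiableAt) hGW
      (by
        rw [hdG]
        refine hW3.mono' (hW.mul (hFc.measurable.comp hW)).aestronglyMeasurable
          (.of_forall fun ω => ?_)
        rw [norm_mul]
        exact (mul_le_mul_of_nonneg_left (hFle _) (norm_nonneg _)).trans_eq
          (by rw [Real.norm_eq_abs]; ring))
      (by rw [hdG, hdF]; exact hint n)
    have hG0 : G 0 = 0 := intervalIntegral.integral_same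
    rw [hdG, hdF, hG0, sub_zero, ← hv] at h
    rw [le_div_iff₀' hvpos, ← h]
    exact integral_mono hGW hW3 fun ω => (le_abs_self _).trans (hGle _)
  have hcover : AECover (volume : Measure Ω) Filter.atTop
      fun n : ℕ => {ω | |WL ω| ≤ (n : ℝ)} :=
    { ae_eventually_mem := .of_forall fun ω => by
        filter_upwards [Filter.eventually_ge_atTop ⌈|WL ω|⌉₊] with n hn
        exact Nat.ceil_le.1 hn
      measurableSet := fun n => measurableSet_le (by fun_prop) measurable_const }
  refine hcover.integrable_of_integral_norm_bounded ((∫ ω, |W ω| ^ 3) / v) (fun n => ?_)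
    (.of_forall fun n => ?_)
  · exact Measure.integrableOn_of_bounded (M := n) (measure_ne_top _ _)
      hWL.aestronglyMeasurable
      ((ae_restrict_iff' (hcover.measurableSet n)).2 (.of_forall fun ω hω => hω))
  · calc ∫ ω in {ω | |WL ω| ≤ (n : ℝ)}, ‖WL ω‖
        = ∫ ω in {ω | |WL ω| ≤ (n : ℝ)}, min |WL ω| (n : ℝ) :=
          setIntegral_congr_fun (hcover.measurableSet n) fun ω hω => (min_eq_left hω).symm
      _ ≤ ∫ ω, min |WL ω| (n : ℝ) :=
          setIntegral_le_integral (hint n)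
            (.of_forall fun ω => le_min (abs_nonneg _) n.cast_nonneg)
      _ ≤ _ := hbound n

lemma integrable_id_conv {μ ν : Measure ℝ} [IsProbabilityMeasure μ] [IsProbabilityMeasure ν]
    (hμ : Integrable (fun x : ℝ => x) μ) (hν : Integrable (fun x : ℝ => x) ν) :
    Integrable (fun x : ℝ => x) (μ.conv ν) := by
  rw [Measure.conv, integrable_map_measure (by fun_prop) (by fun_prop)]
  exact (hμ.comp_fst ν).add (hν.comp_snd μ)

lemma LipschitzWith.integrable_of_integrable_id {μ : Measure ℝ} [IsProbabilityMeasure μ]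
    {h : ℝ → ℝ} (hh : LipschitzWith 1 h) (hμ : Integrable (fun x : ℝ => x) μ) :
    Integrable h μ := by
  refine ((integrable_const |h 0|).add hμ.abs).mono'
    hh.continuous.aestronglyMeasurable (.of_forall fun x => ?_)
  have := hh.dist_le_mul x 0
  simp only [Real.dist_eq, NNReal.coe_one, one_mul, sub_zero] at this
  calc |h x| = |h 0 + (h x - h 0)| := by ring_nf
    _ ≤ |h 0| + |h x - h 0| := abs_add_le _ _
    _ ≤ |h 0| + |x| := by gcongr

/-- A test function whose `ν`-average over translates is `K`-Lipschitz separates `WL` from `ν`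
by at most `K * E|W - WL|`, provided the mixture identity of `map_add_conv_laplaceDist` holds. -/
lemma abs_integral_map_sub_integral_le {Ω : Type*} [MeasureSpace Ω]
    [IsProbabilityMeasure (volume : Measure Ω)] {W WL : Ω → ℝ} (hW : Integrable W)
    (hWL : Integrable WL) {ν : Measure ℝ} [IsProbabilityMeasure ν]
    (hlaw : Measure.map WL volume + (Measure.map W volume).conv ν =
      (Measure.map WL volume).conv ν + ν)
    {h : ℝ → ℝ} (hν : Integrable h ν) (hμ : Integrable h (Measure.map WL volume))
    (hWν : Integrable h ((Measure.map W volume).conv ν))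
    (hWLν : Integrable h ((Measure.map WL volume).conv ν)) {K : ℝ} (hK : 0 ≤ K)
    (hlip : ∀ x y, |∫ z, h (x + z) ∂ν - ∫ z, h (y + z) ∂ν| ≤ K * |x - y|) :
    |∫ x, h x ∂(Measure.map WL volume) - ∫ x, h x ∂ν| ≤ K * ∫ ω, |W ω - WL ω| := by
  have := Measure.isProbabilityMeasure_map (μ := (volume : Measure Ω)) hW.aemeasurable
  have := Measure.isProbabilityMeasure_map (μ := (volume : Measure Ω)) hWL.aemeasurable
  set H : ℝ → ℝ := fun x => ∫ z, h (x + z) ∂ν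
  have hHc : Continuous H :=
    (LipschitzWith.of_dist_le_mul (K := ⟨K, hK⟩) fun x y => hlip x y).continuous
  have hHint {X : Ω → ℝ} (hX : Integrable X) : Integrable fun ω => H (X ω) := by
    refine ((integrable_const |H 0|).add (hX.abs.const_mul K)).mono'
      (hHc.comp_aestronglyMeasurable hX.1) (.of_forall fun ω => ?_)
    have := hlip (X ω) 0
    rw [sub_zero] at this
    calc |H (X ω)| = |H 0 + (H (X ω) - H 0)| := by ring_nf
      _ ≤ |H 0| + |H (X ω) - H 0| := abs_add_le _ _
      _ ≤ |H 0| + K * |X ω| := by gcongr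
  have hconv {X : Ω → ℝ} (hX : Integrable X)
      (hXν : Integrable h ((Measure.map X volume).conv ν)) :
      ∫ x, h x ∂((Measure.map X volume).conv ν) = ∫ ω, H (X ω) := by
    have := Measure.isProbabilityMeasure_map (μ := (volume : Measure Ω)) hX.aemeasurable
    rw [integral_conv hXν]
    exact integral_map hX.aemeasurable hHc.aestronglyMeasurable
  have hsum : ∫ x, h x ∂(Measure.map WL volume) + ∫ x, h x ∂((Measure.map W volume).conv ν) =
      ∫ x, h x ∂((Measure.map WL volume).conv ν) + ∫ x, h x ∂ν := by
    rw [← integral_add_measure hμ hWν, hlaw, integral_add_measure hWLν hν]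
  rw [hconv hW hWν, hconv hWL hWLν] at hsum
  have hdiff : ∫ x, h x ∂(Measure.map WL volume) - ∫ x, h x ∂ν =
      ∫ ω, (H (WL ω) - H (W ω)) := by
    rw [integral_sub (hHint hWL) (hHint hW)]
    linarith
  rw [hdiff, ← integral_const_mul]
  refine abs_integral_le_integral_abs.trans
    (integral_mono ((hHint hWL).sub (hHint hW)).abs ((hW.sub hWL).abs.const_mul K) fun ω => ?_)
  simpa only [abs_sub_comm (W ω)] using hlip (WL ω) (W ω)

/-- Theorem 2.4: Laplace approximation bounds via the centered equilibrium distribution. -/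
theorem centered_equilibrium_wasserstein_kolmogorov_WL
    {Ω : Type*} [MeasureSpace Ω] [IsProbabilityMeasure (volume : Measure Ω)]
    (W WL : Ω → ℝ) (hWmeas : Measurable W) (hWLmeas : Measurable WL)
    (b : ℝ) (hb : 0 < b)
    (hWmean : ∫ ω, W ω = 0)
    (hWsqInt : Integrable fun ω => (W ω) ^ 2)
    (hWvar : ∫ ω, (W ω) ^ 2 = 2 * b ^ 2)
    (hCE : IsCenteredEquilibrium W WL)
    (hW3Int : Integrable fun ω => |W ω| ^ 3) :
    wassDist (Measure.map WL volume) (laplaceDist b) ≤ (∫ ω, |W ω - WL ω|) ∧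
      kolDist (Measure.map WL volume) (laplaceDist b) ≤ (1 / b) * ∫ ω, |W ω - WL ω| := by
  have := isProbabilityMeasure_laplaceDist hb
  have := Measure.isProbabilityMeasure_map (μ := (volume : Measure Ω)) hWmeas.aemeasurable
  have := Measure.isProbabilityMeasure_map (μ := (volume : Measure Ω)) hWLmeas.aemeasurable
  have hW := integrable_of_integrable_sq_s12 hWmeas hWsqInt
  have hWL := hCE.integrable hWmeas hWLmeas (by rw [hWvar]; positivity) hW3Int
  have hlaw := map_add_conv_laplaceDist hWmeas hWLmeas hb hWsqInt hWvar hCE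
  have hnonneg : 0 ≤ ∫ ω, |W ω - WL ω| := integral_nonneg fun ω => abs_nonneg _
  constructor
  · refine Real.iSup_le (fun ⟨h, hh⟩ => ?_) hnonneg
    have hZ := integrable_id_laplaceDist hb
    have hidW : Integrable (fun x : ℝ => x) (Measure.map W volume) :=
      (integrable_map_measure (by fun_prop) (by fun_prop)).2 hW
    have hidWL : Integrable (fun x : ℝ => x) (Measure.map WL volume) :=
      (integrable_map_measure (by fun_prop) (by fun_prop)).2 hWL
    rw [← one_mul (∫ ω, |W ω - WL ω|)]
    refine abs_integral_map_sub_integral_le hW hWL hlaw (hh.integrable_of_integrable_id hZ)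
      (hh.integrable_of_integrable_id hidWL)
      (hh.integrable_of_integrable_id (integrable_id_conv hidW hZ))
      (hh.integrable_of_integrable_id (integrable_id_conv hidWL hZ)) zero_le_one fun x y => ?_
    have hshift (a : ℝ) : Integrable (fun z => h (a + z)) (laplaceDist b) := by
      have hh' : LipschitzWith 1 fun z => h (a + z) := by
        refine .of_dist_le_mul fun u v => ?_
        simpa using hh.dist_le_mul (a + u) (a + v)
      exact hh'.integrable_of_integrable_id hZ
    rw [← integral_sub (hshift x) (hshift y)]
    rw [← Real.norm_eq_abs]
    refine (norm_integral_le_of_norm_le_const (C := |x - y|) (.of_forall fun z => ?_)).trans ?_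
    · simpa [Real.dist_eq] using hh.dist_le_mul (x + z) (y + z)
    · simp
  · refine Real.iSup_le (fun z => ?_) (by positivity)
    have hind (ρ : Measure ℝ) [IsProbabilityMeasure ρ] :
        Integrable ((Iic z).indicator (1 : ℝ → ℝ)) ρ :=
      (integrable_const 1).indicator measurableSet_Iic
    have hbound := abs_integral_map_sub_integral_le hW hWL hlaw (hind _) (hind _) (hind _)
      (hind _) (K := 1 / b) (by positivity) fun x y => by
        have htranslate (a : ℝ) : ∫ u, (Iic z).indicator (1 : ℝ → ℝ) (a + u) ∂(laplaceDist b) =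
            (laplaceDist b).real (Iic (z - a)) := by
          rw [← integral_indicator_one measurableSet_Iic]
          refine integral_congr_ae (.of_forall fun u => ?_)
          simp only [indicator, mem_Iic, le_sub_iff_add_le', Pi.one_apply]
        rw [htranslate, htranslate]
        refine (abs_laplaceDist_Iic_sub_le hb _ _).trans_eq ?_
        rw [sub_sub_sub_cancel_left, abs_sub_comm]
    rwa [integral_indicator_one measurableSet_Iic,
      integral_indicator_one measurableSet_Iic] at hbound
end

section
/- Let n ≥ 2, let B_{n−1} ~ Beta(1, n−1) and define U_n = √(n·B_{n−1}). Let U follow the Rayleigh distribution with density 2x·e^{−x²} on (0,∞). Then d_K(U_n, U) ≤ 2/n and d_W(U_n, U) ≤ 11.49/n. -/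
open MeasureTheory ProbabilityTheory Real Set

/-- The Rayleigh distribution with density 2x·e^{−x²} on (0,∞). -/
noncomputable def rayleighUnitDist : Measure ℝ :=
  (volume : Measure ℝ).withDensity fun x =>
    ENNReal.ofReal (if 0 < x then 2 * x * Real.exp (-x ^ 2) else 0)

theorem rayleighUnitDist_Iic (z : ℝ) :
    rayleighUnitDist (Iic z) = ENNReal.ofReal (if 0 ≤ z then 1 - exp (-z ^ 2) else 0) := by
  have hd : (fun x : ℝ => ENNReal.ofReal (if 0 < x then 2 * x * exp (-x ^ 2) else 0)) =
      (Ioi 0).indicator fun x => ENNReal.ofReal (2 * x * exp (-x ^ 2)) := by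
    ext x
    by_cases hx : 0 < x <;> simp [hx]
  rw [rayleighUnitDist, withDensity_apply _ measurableSet_Iic, hd,
    setLIntegral_indicator measurableSet_Ioi, Ioi_inter_Iic]
  split_ifs with hz
  · have hc : Continuous fun x : ℝ => 2 * x * exp (-x ^ 2) := by fun_prop
    rw [← ofReal_integral_eq_lintegral_ofReal hc.integrableOn_Ioc,
      ← intervalIntegral.integral_of_le hz,
      intervalIntegral.integral_eq_sub_of_hasDerivAt (f := fun x => -exp (-x ^ 2))]
    · congr 1
      simp
      ring
    · intro x _
      exact (hasDerivAt_pow 2 x).neg.exp.neg.congr_deriv (by simp; ring)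
    · exact hc.intervalIntegrable _ _
    · filter_upwards [ae_restrict_mem measurableSet_Ioc] with x hx
      have := hx.1
      positivity
  · simp [Ioc_eq_empty_of_le (not_le.1 hz).le]

theorem betaOneDist_Iic {m : ℕ} (hm : m ≠ 0) (x : ℝ) :
    betaOneDist m (Iic x) =
      ENNReal.ofReal (if x < 0 then 0 else if x < 1 then 1 - (1 - x) ^ m else 1) := by
  have hd : (fun x : ℝ => ENNReal.ofReal (if 0 < x ∧ x < 1 then m * (1 - x) ^ (m - 1) else 0)) =
      (Ioo 0 1).indicator fun x => ENNReal.ofReal (m * (1 - x) ^ (m - 1)) := by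
    ext x
    by_cases hx : 0 < x ∧ x < 1
    · rw [indicator_of_mem (by exact hx), if_pos hx]
    · rw [indicator_of_notMem (by exact hx), if_neg hx, ENNReal.ofReal_zero]
  have key : ∀ y : ℝ, 0 ≤ y → y ≤ 1 →
      ∫⁻ x in Ioc 0 y, ENNReal.ofReal (m * (1 - x) ^ (m - 1)) =
        ENNReal.ofReal (1 - (1 - y) ^ m) := by
    intro y hy hy1
    have hc : Continuous fun x : ℝ => (m : ℝ) * (1 - x) ^ (m - 1) := by fun_prop
    rw [← ofReal_integral_eq_lintegral_ofReal hc.integrableOn_Ioc,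
      ← intervalIntegral.integral_of_le hy,
      intervalIntegral.integral_eq_sub_of_hasDerivAt (f := fun x => -(1 - x) ^ m)]
    · congr 1
      simp
      ring
    · intro x _
      exact (((hasDerivAt_id x).const_sub 1).pow m).neg.congr_deriv (by simp)
    · exact hc.intervalIntegrable _ _
    · filter_upwards [ae_restrict_mem measurableSet_Ioc] with x hx
      have : 0 ≤ 1 - x := by linarith [hx.2]
      positivity
  rw [betaOneDist, withDensity_apply _ measurableSet_Iic, hd,
    setLIntegral_indicator measurableSet_Ioo]
  split_ifs with h0 h1
  · have : Ioo (0 : ℝ) 1 ∩ Iic x = ∅ := by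
      ext y
      simp only [mem_inter_iff, mem_Ioo, mem_Iic, mem_empty_iff_false, iff_false]
      intro h
      linarith [h.1.1, h.2]
    simp [this]
  · have : Ioo (0 : ℝ) 1 ∩ Iic x = Ioc 0 x := by
      ext y
      simp only [mem_inter_iff, mem_Ioo, mem_Iic, mem_Ioc]
      exact ⟨fun h => ⟨h.1.1, h.2⟩, fun h => ⟨⟨h.1, h.2.trans_lt h1⟩, h.2⟩⟩
    rw [this, key x (not_lt.1 h0) h1.le]
  · have : Ioo (0 : ℝ) 1 ∩ Iic x = Ioo 0 1 := by
      refine inter_eq_left.2 fun y hy => ?_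
      exact hy.2.le.trans (not_lt.1 h1)
    rw [this, Measure.restrict_congr_set Ioo_ae_eq_Ioc, key 1 zero_le_one le_rfl]
    simp [hm]

instance : IsProbabilityMeasure rayleighUnitDist := by
  constructor
  have h := tendsto_measure_iUnion_atTop (μ := rayleighUnitDist) (s := fun z : ℝ => Iic z)
    (fun a b hab => Iic_subset_Iic.2 hab)
  rw [iUnion_Iic] at h
  refine tendsto_nhds_unique h ?_
  have h2 : Filter.Tendsto (fun z : ℝ => ENNReal.ofReal (1 - exp (-z ^ 2))) Filter.atTop
      (nhds (ENNReal.ofReal (1 - 0))) := by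
    refine (ENNReal.continuous_ofReal.tendsto _).comp (Filter.Tendsto.const_sub _ ?_)
    exact tendsto_exp_atBot.comp (Filter.tendsto_neg_atTop_atBot.comp
      (Filter.tendsto_pow_atTop two_ne_zero))
  rw [sub_zero, ENNReal.ofReal_one] at h2
  refine h2.congr' ?_
  filter_upwards [Filter.eventually_ge_atTop 0] with z hz
  simp [rayleighUnitDist_Iic, hz]

theorem ae_pos_rayleighUnitDist : ∀ᵐ z ∂rayleighUnitDist, 0 < z := by
  have : rayleighUnitDist (Iic 0) = 0 := by simp [rayleighUnitDist_Iic]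
  rw [ae_iff]
  convert this using 2
  ext z
  simp

theorem map_rayleighUnitDist_eq_betaOneDist {m : ℕ} (hm : m ≠ 0) :
    rayleighUnitDist.map (fun z => 1 - exp (-z ^ 2 / m)) = betaOneDist m := by
  have hm0 : (0 : ℝ) < m := by positivity
  have hψ : Measurable fun z : ℝ => 1 - exp (-z ^ 2 / m) := by fun_prop
  have : IsProbabilityMeasure (rayleighUnitDist.map fun z : ℝ => 1 - exp (-z ^ 2 / m)) :=
    Measure.isProbabilityMeasure_map hψ.aemeasurable
  refine Measure.ext_of_Iic _ _ fun x => ?_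
  rw [Measure.map_apply hψ measurableSet_Iic, betaOneDist_Iic hm]
  split_ifs with h0 h1
  · have : (fun z : ℝ => 1 - exp (-z ^ 2 / m)) ⁻¹' Iic x = ∅ := by
      ext z
      simp only [mem_preimage, mem_Iic, mem_empty_iff_false, iff_false, not_le]
      have : exp (-z ^ 2 / m) ≤ 1 := by
        rw [exp_le_one_iff, neg_div]
        exact neg_nonpos.2 (by positivity)
      linarith
    simp [this]
  · have hx : 0 < 1 - x := by linarith
    set s := √(-(m * log (1 - x)))
    have hl : log (1 - x) ≤ 0 := log_nonpos hx.le (by linarith)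
    have hs : s ^ 2 = -(m * log (1 - x)) :=
      sq_sqrt (neg_nonneg.2 (mul_nonpos_of_nonneg_of_nonpos hm0.le hl))
    have : (fun z : ℝ => 1 - exp (-z ^ 2 / m)) ⁻¹' Iic x =ᵐ[rayleighUnitDist] Iic s := by
      filter_upwards [ae_pos_rayleighUnitDist] with z hz
      refine propext (?_ : 1 - exp (-z ^ 2 / m) ≤ x ↔ z ≤ s)
      rw [sub_le_comm, ← log_le_iff_le_exp hx, le_div_iff₀ hm0, le_sqrt' hz]
      constructor <;> intro h <;> linarith
    rw [measure_congr this, rayleighUnitDist_Iic, if_pos (sqrt_nonneg _), hs, neg_neg,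
      ← log_pow, exp_log (by positivity)]
  · have : (fun z : ℝ => 1 - exp (-z ^ 2 / m)) ⁻¹' Iic x = univ := by
      ext z
      simp only [mem_preimage, mem_Iic, mem_univ, iff_true]
      linarith [exp_pos (-z ^ 2 / m)]
    simp [this]

theorem abs_one_sub_div_pow_sub_exp_neg_le {m : ℕ} (hm : m ≠ 0) {t : ℝ} (ht : 0 ≤ t)
    (ht1 : t < m + 1) :
    |(1 - t / (m + 1)) ^ m - exp (-t)| ≤ 2 / (m + 1) := by
  have hn : (0 : ℝ) < m + 1 := by positivity
  have hm1 : (1 : ℝ) ≤ m := by exact_mod_cast Nat.one_le_iff_ne_zero.2 hm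
  have hu : t / (m + 1) < 1 := (div_lt_one hn).2 ht1
  set u := t / (m + 1) with hu_def
  have hu0 : 0 ≤ u := by positivity
  have htu : t = (m + 1) * u := by rw [hu_def]; field_simp
  rw [abs_le]
  constructor
  · have hB : 1 - t * u ≤ (1 - u ^ 2) ^ (m + 1) := by
      have := one_add_mul_le_pow (a := -u ^ 2) (by nlinarith) (m + 1)
      push_cast at this
      rw [htu]
      calc _ = 1 + (m + 1) * (-u ^ 2) := by ring
        _ ≤ _ := this
        _ = _ := by ring
    have hexp : (exp u) ^ (m + 1) = exp t := by
      rw [← exp_nat_mul, htu]; push_cast; rfl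
    have h1 : (1 - u ^ 2) ^ (m + 1) ≤ (1 - u) ^ (m + 1) * exp t := by
      rw [← hexp, ← mul_pow]
      refine pow_le_pow_left₀ (by nlinarith) ?_ _
      nlinarith [add_one_le_exp u]
    have h2 : (1 - u) ^ (m + 1) ≤ (1 - u) ^ m :=
      pow_le_pow_of_le_one (by linarith) (by linarith) (Nat.le_succ m)
    have h3 : t ^ 2 ≤ 2 * exp t := by linarith [quadratic_le_exp_of_nonneg ht]
    have h4 : t * u ≤ 2 / (m + 1) * exp t := by
      rw [hu_def, mul_div_assoc', div_mul_eq_mul_div, div_le_div_iff_of_pos_right hn]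
      linarith
    have h5 : (1 : ℝ) ≤ ((1 - u) ^ m + 2 / (m + 1)) * exp t := by
      nlinarith [mul_le_mul_of_nonneg_right h2 (exp_pos t).le]
    have h6 : exp (-t) ≤ (1 - u) ^ m + 2 / (m + 1) := by
      rw [exp_neg, inv_le_iff_one_le_mul₀ (exp_pos t)]
      exact h5
    linarith
  · have h1 : (1 - u) ^ m ≤ exp (-(m * u)) := by
      calc (1 - u) ^ m ≤ (exp (-u)) ^ m :=
            pow_le_pow_left₀ (by linarith) (one_sub_le_exp_neg u) _
        _ = _ := by rw [← exp_nat_mul]; ring_nf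
    have h2 : exp (-t) = exp (-(m * u)) * exp (-u) := by
      rw [← exp_add, htu]; ring_nf
    have h3 : (m * u) * exp (-(m * u)) ≤ 1 := by
      rw [exp_neg, ← div_eq_mul_inv, div_le_one (exp_pos _)]
      linarith [add_one_le_exp (m * u)]
    have h4 : u * exp (-(m * u)) ≤ 2 / (m + 1) := by
      rw [le_div_iff₀ hn]
      nlinarith [mul_nonneg hu0 (exp_pos (-(m * u))).le]
    nlinarith [one_sub_le_exp_neg u, exp_pos (-(m * u))]

theorem kolDist_map_sqrt_betaOneDist_le {m : ℕ} (hm : m ≠ 0) :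
    kolDist (Measure.map (fun x => √((m + 1 : ℝ) * x)) (betaOneDist m))
      rayleighUnitDist ≤ 2 / (m + 1 : ℝ) := by
  have hn : (0 : ℝ) < m + 1 := by positivity
  refine Real.iSup_le (fun z => ?_) (by positivity)
  rw [Measure.map_apply (by fun_prop) measurableSet_Iic, rayleighUnitDist_Iic]
  by_cases hz : 0 ≤ z
  · have : (fun x : ℝ => √((m + 1 : ℝ) * x)) ⁻¹' Iic z = Iic (z ^ 2 / (m + 1)) := by
      ext x
      simp only [mem_preimage, mem_Iic]
      rw [sqrt_le_left hz, le_div_iff₀' hn]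
    have hz2 : ¬ z ^ 2 / (m + 1) < 0 := not_lt.2 (by positivity)
    have he : exp (-z ^ 2) ≤ 1 := exp_le_one_iff.2 (neg_nonpos.2 (sq_nonneg z))
    rw [this, betaOneDist_Iic hm, if_neg hz2, if_pos hz, ENNReal.toReal_ofReal (sub_nonneg.2 he)]
    split_ifs with h1
    · have hlt : z ^ 2 < m + 1 := (div_lt_one hn).1 h1
      have hpow : (1 - z ^ 2 / (m + 1)) ^ m ≤ 1 :=
        pow_le_one₀ (by linarith) (by linarith [not_lt.1 hz2])
      rw [ENNReal.toReal_ofReal (by linarith), sub_sub_sub_cancel_left, abs_sub_comm]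
      exact abs_one_sub_div_pow_sub_exp_neg_le hm (sq_nonneg z) hlt
    · have hle : (m + 1 : ℝ) ≤ z ^ 2 := (one_le_div hn).1 (not_lt.1 h1)
      rw [ENNReal.toReal_ofReal zero_le_one, sub_sub_cancel, abs_of_pos (exp_pos _), exp_neg,
        inv_le_comm₀ (exp_pos _) (by positivity), inv_div]
      linarith [add_one_le_exp (z ^ 2)]
  · have : (fun x : ℝ => √((m + 1 : ℝ) * x)) ⁻¹' Iic z = ∅ := by
      ext x
      simp only [mem_preimage, mem_Iic, mem_empty_iff_false, iff_false]
      intro h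
      exact hz ((sqrt_nonneg _).trans h)
    rw [this, if_neg hz]
    simp
    positivity

theorem abs_sqrt_sub_mul_le {m : ℕ} (hm : m ≠ 0) {z : ℝ} (hz : 0 < z) :
    |√((m + 1 : ℝ) * (1 - exp (-z ^ 2 / m))) - z| * (2 * z) ≤
      (2 * z + 6 * z ^ 3 + 4 * z ^ 5) / (m + 1) := by
  have hn : (0 : ℝ) < m + 1 := by positivity
  have hm0 : (0 : ℝ) < m := by positivity
  have hm1 : (1 : ℝ) ≤ m := by exact_mod_cast Nat.one_le_iff_ne_zero.2 hm
  set w := z ^ 2 / m with hw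
  have hw0 : 0 ≤ w := by positivity
  have hzw : z ^ 2 = m * w := by rw [hw]; field_simp
  rw [neg_div, ← hw]
  have he0 : exp (-w) ≤ 1 := exp_le_one_iff.2 (by linarith)
  have he1 : 1 - w ≤ exp (-w) := one_sub_le_exp_neg w
  have he2 : exp (-w) ≤ 1 - w + w ^ 2 := by
    rcases le_total w 1 with h | h
    · have := abs_exp_sub_one_sub_id_le (x := -w) (by rwa [abs_neg, abs_of_nonneg hw0])
      nlinarith [(abs_le.1 this).2]
    · nlinarith
  set φ := √((m + 1 : ℝ) * (1 - exp (-w)))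
  have hφ0 : 0 ≤ φ := sqrt_nonneg _
  have hφ : φ ^ 2 = (m + 1 : ℝ) * (1 - exp (-w)) := sq_sqrt (mul_nonneg hn.le (by linarith))
  have h1 : |φ - z| * z ≤ |φ ^ 2 - z ^ 2| := by
    rw [show φ ^ 2 - z ^ 2 = (φ - z) * (φ + z) by ring, abs_mul,
      abs_of_pos (by linarith : 0 < φ + z)]
    gcongr
    linarith
  have h2 : |φ ^ 2 - z ^ 2| * (m + 1) ≤ 2 * z ^ 2 + 4 * z ^ 4 := by
    have e : (m : ℝ) * w ≥ 0 := by positivity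
    rw [hφ, show z ^ 4 = (m * w) ^ 2 by rw [← hzw]; ring, hzw, ← abs_of_pos hn, ← abs_mul,
      abs_of_pos hn, abs_le]
    constructor
    · have h3 : (m + 1 : ℝ) * w ≤ 2 * (m * w) := by nlinarith
      have h4 : ((m + 1 : ℝ) * w) ^ 2 ≤ (2 * (m * w)) ^ 2 :=
        pow_le_pow_left₀ (by positivity) h3 2
      have h5 : (m + 1 : ℝ) ^ 2 * (w - w ^ 2) ≤ (m + 1 : ℝ) ^ 2 * (1 - exp (-w)) :=
        mul_le_mul_of_nonneg_left (by linarith) (sq_nonneg _)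
      nlinarith
    · have h5 : (m + 1 : ℝ) ^ 2 * (1 - exp (-w)) ≤ (m + 1 : ℝ) ^ 2 * w :=
        mul_le_mul_of_nonneg_left (by linarith) (sq_nonneg _)
      nlinarith
  rw [le_div_iff₀ hn]
  have h3 : |φ - z| * z * (m + 1) ≤ 2 * z ^ 2 + 4 * z ^ 4 :=
    (mul_le_mul_of_nonneg_right h1 hn.le).trans h2
  have h4 : 0 ≤ z * (z - 1) ^ 2 := by positivity
  have h5 : 0 ≤ z ^ 3 * (z - 1) ^ 2 := by positivity
  nlinarith

theorem lintegral_Ioi_mul_exp_neg_sq :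
    ∫⁻ z in Ioi (0 : ℝ), ENNReal.ofReal ((2 * z + 6 * z ^ 3 + 4 * z ^ 5) * exp (-z ^ 2)) =
      ENNReal.ofReal 8 := by
  have hderiv : ∀ z ∈ Ioi (0 : ℝ),
      HasDerivAt (fun z : ℝ => -((2 * (z ^ 2) ^ 2 + 7 * z ^ 2 + 8) * exp (-z ^ 2)))
        ((2 * z + 6 * z ^ 3 + 4 * z ^ 5) * exp (-z ^ 2)) z := by
    intro z _
    have h2 := hasDerivAt_pow 2 z
    exact ((((h2.pow 2).const_mul 2).add (h2.const_mul 7)).add_const 8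
      |>.mul h2.neg.exp).neg.congr_deriv (by simp; ring)
  have hcont : ContinuousWithinAt
      (fun z : ℝ => -((2 * (z ^ 2) ^ 2 + 7 * z ^ 2 + 8) * exp (-z ^ 2))) (Ici 0) 0 := by
    fun_prop
  have hpos : ∀ z ∈ Ioi (0 : ℝ), 0 ≤ (2 * z + 6 * z ^ 3 + 4 * z ^ 5) * exp (-z ^ 2) := by
    intro z hz
    have : 0 < z := hz
    positivity
  have hlim : Filter.Tendsto
      (fun z : ℝ => -((2 * (z ^ 2) ^ 2 + 7 * z ^ 2 + 8) * exp (-z ^ 2))) Filter.atTop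
      (nhds 0) := by
    have ht : Filter.Tendsto (fun t : ℝ => -((2 * t ^ 2 + 7 * t + 8) * exp (-t))) Filter.atTop
        (nhds 0) := by
      have h := ((((tendsto_pow_mul_exp_neg_atTop_nhds_zero 2).const_mul 2).add
        ((tendsto_pow_mul_exp_neg_atTop_nhds_zero 1).const_mul 7)).add
        ((tendsto_pow_mul_exp_neg_atTop_nhds_zero 0).const_mul 8)).neg
      simp only [mul_zero, add_zero, neg_zero] at h
      refine h.congr fun t => ?_
      ring
    exact ht.comp (Filter.tendsto_pow_atTop two_ne_zero)
  rw [← ofReal_integral_eq_lintegral_ofReal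
      (integrableOn_Ioi_deriv_of_nonneg hcont hderiv hpos hlim),
    integral_Ioi_of_hasDerivAt_of_nonneg hcont hderiv hpos hlim]
  · simp
  · filter_upwards [ae_restrict_mem measurableSet_Ioi] with z hz using hpos z hz

theorem lintegral_abs_sqrt_sub_rayleighUnitDist_le {m : ℕ} (hm : m ≠ 0) :
    ∫⁻ z, ENNReal.ofReal |√((m + 1 : ℝ) * (1 - exp (-z ^ 2 / m))) - z| ∂rayleighUnitDist ≤
      ENNReal.ofReal (8 / (m + 1)) := by
  have hn : (0 : ℝ) < m + 1 := by positivity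
  have hmeas : Measurable fun x : ℝ =>
      ENNReal.ofReal (if 0 < x then 2 * x * exp (-x ^ 2) else 0) :=
    (Measurable.ite measurableSet_Ioi (by fun_prop) measurable_const).ennreal_ofReal
  rw [rayleighUnitDist, lintegral_withDensity_eq_lintegral_mul _ hmeas (by fun_prop)]
  calc _ ≤ ∫⁻ z, (Ioi 0).indicator (fun z : ℝ => ENNReal.ofReal (m + 1)⁻¹ *
        ENNReal.ofReal ((2 * z + 6 * z ^ 3 + 4 * z ^ 5) * exp (-z ^ 2))) z := by
        refine lintegral_mono fun z => ?_
        by_cases hz : 0 < z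
        · rw [indicator_of_mem (by exact hz), Pi.mul_apply, if_pos hz,
            ← ENNReal.ofReal_mul (by positivity), ← ENNReal.ofReal_mul (by positivity)]
          refine ENNReal.ofReal_le_ofReal ?_
          have := mul_le_mul_of_nonneg_right (abs_sqrt_sub_mul_le hm hz) (exp_pos (-z ^ 2)).le
          calc _ = _ := by ring
            _ ≤ _ := this
            _ = _ := by ring
        · simp [hz]
    _ = ENNReal.ofReal (8 / (m + 1)) := by
        rw [lintegral_indicator measurableSet_Ioi, lintegral_const_mul _ (by fun_prop),
          lintegral_Ioi_mul_exp_neg_sq, ← ENNReal.ofReal_mul (by positivity)]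
        congr 1
        ring

theorem wassDist_map_sqrt_betaOneDist_le {m : ℕ} (hm : m ≠ 0) :
    wassDist (Measure.map (fun x => √((m + 1 : ℝ) * x)) (betaOneDist m))
      rayleighUnitDist ≤ 8 / (m + 1 : ℝ) := by
  have hn : (0 : ℝ) < m + 1 := by positivity
  refine Real.iSup_le (fun ⟨h, hh⟩ => ?_) (by positivity)
  have hhm : Measurable h := hh.continuous.measurable
  set φ : ℝ → ℝ := fun z => √((m + 1 : ℝ) * (1 - exp (-z ^ 2 / m))) with hφ
  have hφm : Measurable φ := by fun_prop
  have hmap : Measure.map (fun x => √((m + 1 : ℝ) * x)) (betaOneDist m) =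
      rayleighUnitDist.map φ := by
    rw [← map_rayleighUnitDist_eq_betaOneDist hm, Measure.map_map (by fun_prop) (by fun_prop)]
    rfl
  have hlip : ∀ x y, |h x - h y| ≤ |x - y| := fun x y => by
    simpa [Real.dist_eq] using hh.dist_le_mul x y
  have hle : ∫⁻ z, ENNReal.ofReal ‖h (φ z) - h z‖ ∂rayleighUnitDist ≤
      ENNReal.ofReal (8 / (m + 1)) :=
    (lintegral_mono fun z => ENNReal.ofReal_le_ofReal (hlip _ _)).trans
      (lintegral_abs_sqrt_sub_rayleighUnitDist_le hm)
  have hdiff : Integrable (fun z => h (φ z) - h z) rayleighUnitDist := by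
    refine ⟨((hhm.comp hφm).sub hhm).aestronglyMeasurable, ?_⟩
    rw [hasFiniteIntegral_iff_norm]
    exact hle.trans_lt ENNReal.ofReal_lt_top
  have hcomp : Integrable (fun z => h (φ z)) rayleighUnitDist := by
    refine Integrable.of_bound (hhm.comp hφm).aestronglyMeasurable (|h 0| + √(m + 1))
      (Filter.Eventually.of_forall fun z => ?_)
    have hφz : |φ z| ≤ √(m + 1) := by
      rw [abs_of_nonneg (sqrt_nonneg _)]
      refine sqrt_le_sqrt ?_
      nlinarith [exp_pos (-z ^ 2 / m)]
    have h1 := hlip (φ z) 0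
    rw [sub_zero] at h1
    have h2 := abs_add_le (h 0) (h (φ z) - h 0)
    rw [add_sub_cancel] at h2
    rw [Real.norm_eq_abs]
    linarith
  have hint : Integrable h rayleighUnitDist :=
    (hcomp.sub hdiff).congr (Filter.Eventually.of_forall fun z => by simp)
  rw [hmap, integral_map hφm.aemeasurable hhm.aestronglyMeasurable, ← integral_sub hcomp hint,
    ← Real.norm_eq_abs]
  exact (norm_integral_le_lintegral_norm _).trans
    (ENNReal.toReal_le_of_le_ofReal (by positivity) hle)

/-- Lemma 4.5: Kolmogorov and Wasserstein bounds for the Rayleigh approximation of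
`U_n = √(n·B_{n−1})` where `B_{n−1} ~ Beta(1, n−1)`. -/
theorem beta_to_rayleigh_bounds (n : ℕ) (hn : 2 ≤ n) :
    kolDist (Measure.map (fun x => Real.sqrt ((n : ℝ) * x)) (betaOneDist (n - 1)))
        rayleighUnitDist ≤ 2 / (n : ℝ) ∧
    wassDist (Measure.map (fun x => Real.sqrt ((n : ℝ) * x)) (betaOneDist (n - 1)))
        rayleighUnitDist ≤ 11.49 / (n : ℝ) := by
  obtain ⟨m, rfl⟩ : ∃ m, n = m + 1 := ⟨n - 1, by omega⟩
  have hm : m ≠ 0 := by omega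
  rw [Nat.add_sub_cancel]
  push_cast
  refine ⟨kolDist_map_sqrt_betaOneDist_le hm, (wassDist_map_sqrt_betaOneDist_le hm).trans ?_⟩
  gcongr
  norm_num
end

section
/- Let k > 0 and let K follow the chi distribution with k degrees of freedom, with density ρ_k(x) = x^{k−1} e^{−x²/2} / (2^{k/2−1} Γ(k/2)) on (0,∞). Let h: (0,∞) → ℝ be bounded and measurable, and let f: (0,∞) → ℝ be defined by f(x) = (1/(x·ρ_k(x))) ∫_0^x (h(t) − E[h(K)]) ρ_k(t) dt, which solves the Stein equation x f'(x) + (k − x²) f(x) = h(x) − E[h(K)]. Then sup_{x>0} |f(x)| ≤ (Γ(k/2)·e^{k/2}/(2·(k/2)^{k/2})) · sup_{x>0} |h(x) − E[h(K)]| and sup_{x>0} |x f'(x)| ≤ 2 · sup_{x>0} |h(x) − E[h(K)]|. -/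
open MeasureTheory ProbabilityTheory Real Set

open Filter Topology

/-- The density of the chi distribution with `k` degrees of freedom, without its normalizing
constant. -/
noncomputable def chiWeight (k x : ℝ) : ℝ := x ^ (k - 1) * Real.exp (-x ^ 2 / 2)

theorem chiWeight_pos (k : ℝ) {x : ℝ} (hx : 0 < x) : 0 < chiWeight k x := by
  unfold chiWeight
  positivity

theorem mul_chiWeight (k : ℝ) {x : ℝ} (hx : 0 < x) :
    x * chiWeight k x = x ^ k * Real.exp (-x ^ 2 / 2) := by
  rw [chiWeight, ← mul_assoc, Real.rpow_sub_one hx.ne', mul_div_cancel₀ _ hx.ne']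

theorem integrableOn_rpow_mul_exp_neg_sq_div_two {s : ℝ} (hs : -1 < s) :
    IntegrableOn (fun x : ℝ => x ^ s * Real.exp (-x ^ 2 / 2)) (Ioi 0) := by
  have h := integrableOn_rpow_mul_exp_neg_mul_sq (b := 1 / 2) (by norm_num) hs
  refine h.congr_fun (fun x _ => ?_) measurableSet_Ioi
  ring_nf

theorem integrableOn_chiWeight {k : ℝ} (hk : 0 < k) : IntegrableOn (chiWeight k) (Ioi 0) :=
  integrableOn_rpow_mul_exp_neg_sq_div_two (by linarith)

theorem integral_chiWeight {k : ℝ} (hk : 0 < k) :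
    ∫ x in Ioi (0 : ℝ), chiWeight k x = (2 : ℝ) ^ (k / 2 - 1) * Real.Gamma (k / 2) := by
  have h := integral_rpow_mul_exp_neg_mul_rpow (p := 2) (q := k - 1) (b := 1 / 2)
    (by norm_num) (by linarith) (by norm_num)
  have e : (k - 1 + 1) / 2 = k / 2 := by ring
  rw [neg_div, e, one_div, Real.inv_rpow (by norm_num), Real.rpow_neg (by norm_num), inv_inv] at h
  rw [Real.rpow_sub_one (by norm_num)]
  convert h using 1
  · refine setIntegral_congr_fun measurableSet_Ioi fun x _ => ?_
    simp only [chiWeight, Real.rpow_two]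
    ring_nf
  · ring

theorem continuousOn_chiWeight (k : ℝ) : ContinuousOn (chiWeight k) (Ioi 0) := by
  unfold chiWeight
  refine ContinuousOn.mul (fun x hx => ?_) (by fun_prop)
  exact (Real.continuousAt_rpow_const _ _ (Or.inl (ne_of_gt hx))).continuousWithinAt

theorem hasDerivAt_rpow_mul_exp_neg_sq_div_two (k : ℝ) {x : ℝ} (hx : 0 < x) :
    HasDerivAt (fun y : ℝ => y ^ k * Real.exp (-y ^ 2 / 2)) ((k - x ^ 2) * chiWeight k x) x := by
  have h₁ := Real.hasDerivAt_rpow_const (p := k) (Or.inl hx.ne')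
  have h₂ : HasDerivAt (fun y : ℝ => Real.exp (-y ^ 2 / 2))
      (Real.exp (-x ^ 2 / 2) * (-x)) x :=
    (((hasDerivAt_pow 2 x).fun_neg.div_const 2).congr_deriv (by norm_num; ring)).exp
  refine (h₁.fun_mul h₂).congr_deriv ?_
  have := Real.rpow_sub_one hx.ne' k
  have hxk : x ^ k = x * x ^ (k - 1) := by rw [this]; field_simp
  rw [chiWeight, hxk]
  ring

theorem integrableOn_sub_sq_mul_chiWeight {k : ℝ} (hk : 0 < k) :
    IntegrableOn (fun x => (k - x ^ 2) * chiWeight k x) (Ioi 0) := by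
  have h := ((integrableOn_chiWeight hk).const_mul k).sub
    (integrableOn_rpow_mul_exp_neg_sq_div_two (s := k + 1) (by linarith))
  refine IntegrableOn.congr_fun h (fun x (hx : 0 < x) => ?_) measurableSet_Ioi
  have : x ^ (k + 1) = x ^ (k - 1) * x ^ 2 := by
    rw [← Real.rpow_natCast, ← Real.rpow_add hx]
    norm_num
    ring_nf
  simp only [chiWeight, Pi.sub_apply, this]
  ring

theorem continuous_rpow_mul_exp_neg_sq_div_two {k : ℝ} (hk : 0 < k) :
    Continuous (fun y : ℝ => y ^ k * Real.exp (-y ^ 2 / 2)) :=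
  (Real.continuous_rpow_const hk.le).mul (by fun_prop)

theorem tendsto_rpow_mul_exp_neg_sq_div_two (k : ℝ) :
    Tendsto (fun y : ℝ => y ^ k * Real.exp (-y ^ 2 / 2)) atTop (𝓝 0) := by
  have h := (rpow_mul_exp_neg_mul_sq_isLittleO_exp_neg (b := 1 / 2) (by norm_num) k).trans_tendsto
    (Real.tendsto_exp_atBot.comp (tendsto_id.const_mul_atTop_of_neg (r := -(1 / 2)) (by norm_num)))
  refine h.congr fun x => ?_
  ring_nf

theorem integral_Ioc_sub_sq_mul_chiWeight {k x : ℝ} (hk : 0 < k) (hx : 0 < x) :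
    ∫ t in Ioc 0 x, (k - t ^ 2) * chiWeight k t = x * chiWeight k x := by
  rw [← intervalIntegral.integral_of_le hx.le,
    intervalIntegral.integral_eq_sub_of_hasDerivAt_of_le hx.le
      (continuous_rpow_mul_exp_neg_sq_div_two hk).continuousOn
      (fun t ht => hasDerivAt_rpow_mul_exp_neg_sq_div_two k ht.1)
      ((intervalIntegrable_iff_integrableOn_Ioc_of_le hx.le).2
        ((integrableOn_sub_sq_mul_chiWeight hk).mono_set Ioc_subset_Ioi_self)),
    mul_chiWeight k hx, Real.zero_rpow hk.ne']
  simp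

theorem integral_Ioi_sub_sq_mul_chiWeight {k x : ℝ} (hk : 0 < k) (hx : 0 < x) :
    ∫ t in Ioi x, (k - t ^ 2) * chiWeight k t = -(x * chiWeight k x) := by
  rw [integral_Ioi_of_hasDerivAt_of_tendsto
      (continuous_rpow_mul_exp_neg_sq_div_two hk).continuousWithinAt
      (fun t ht => hasDerivAt_rpow_mul_exp_neg_sq_div_two k (hx.trans ht))
      ((integrableOn_sub_sq_mul_chiWeight hk).mono_set (Ioi_subset_Ioi hx.le))
      (tendsto_rpow_mul_exp_neg_sq_div_two k),
    mul_chiWeight k hx, zero_sub]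

theorem sub_sq_mul_integral_Ioc_chiWeight_le {k x : ℝ} (hk : 0 < k) (hx : 0 < x) :
    (k - x ^ 2) * ∫ t in Ioc 0 x, chiWeight k t ≤ x * chiWeight k x := by
  rw [← integral_Ioc_sub_sq_mul_chiWeight hk hx, ← integral_const_mul]
  refine setIntegral_mono_on
    (((integrableOn_chiWeight hk).mono_set Ioc_subset_Ioi_self).const_mul _)
    ((integrableOn_sub_sq_mul_chiWeight hk).mono_set Ioc_subset_Ioi_self) measurableSet_Ioc
    fun t ht => mul_le_mul_of_nonneg_right ?_ (chiWeight_pos k ht.1).le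
  nlinarith [ht.1, ht.2]

theorem sq_sub_mul_integral_Ioi_chiWeight_le {k x : ℝ} (hk : 0 < k) (hx : 0 < x) :
    (x ^ 2 - k) * ∫ t in Ioi x, chiWeight k t ≤ x * chiWeight k x := by
  suffices ∫ t in Ioi x, (k - t ^ 2) * chiWeight k t ≤
      ∫ t in Ioi x, (k - x ^ 2) * chiWeight k t by
    rw [integral_Ioi_sub_sq_mul_chiWeight hk hx, integral_const_mul] at this
    linarith
  refine setIntegral_mono_on
    ((integrableOn_sub_sq_mul_chiWeight hk).mono_set (Ioi_subset_Ioi hx.le))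
    (((integrableOn_chiWeight hk).mono_set (Ioi_subset_Ioi hx.le)).const_mul _) measurableSet_Ioi
    fun t (ht : x < t) => mul_le_mul_of_nonneg_right ?_ (chiWeight_pos k (hx.trans ht)).le
  nlinarith

theorem mul_chiWeight_mul_le (k : ℝ) {r a s : ℝ} (hr : 0 < r) (ha : 0 < a) (hs : 0 < s)
    (h : (1 - r ^ 2) * (s ^ 2 - a ^ 2) ≤ 0) :
    r * chiWeight k (r * s) * (a * chiWeight k a) ≤
      r * a * chiWeight k (r * a) * chiWeight k s := by
  have e : Real.exp (-(r * s) ^ 2 / 2) * Real.exp (-a ^ 2 / 2) ≤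
      Real.exp (-(r * a) ^ 2 / 2) * Real.exp (-s ^ 2 / 2) := by
    rw [← Real.exp_add, ← Real.exp_add]
    exact Real.exp_le_exp.2 (by linarith)
  simp only [chiWeight, Real.mul_rpow hr.le hs.le, Real.mul_rpow hr.le ha.le]
  have := mul_le_mul_of_nonneg_left e
    (by positivity : 0 ≤ r * r ^ (k - 1) * s ^ (k - 1) * a * a ^ (k - 1))
  linarith

theorem integral_Ioc_chiWeight_mul_le {k x y : ℝ} (hk : 0 < k) (hx : 0 < x) (hxy : x ≤ y) :
    (∫ t in Ioc 0 x, chiWeight k t) * (y * chiWeight k y) ≤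
      x * chiWeight k x * ∫ t in Ioc 0 y, chiWeight k t := by
  have hy := hx.trans_le hxy
  have hr : 0 < x / y := by positivity
  have hry : x / y * y = x := by field_simp
  have hr1 : x / y ≤ 1 := (div_le_one hy).2 hxy
  have hsub := intervalIntegral.smul_integral_comp_mul_left (a := 0) (b := y) (chiWeight k) (x / y)
  rw [mul_zero, hry, intervalIntegral.integral_of_le hx.le, intervalIntegral.integral_of_le hy.le,
    smul_eq_mul] at hsub
  rw [← hsub, ← integral_const_mul, ← integral_const_mul, ← integral_mul_const]
  refine integral_mono_of_nonneg ?_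
    (((integrableOn_chiWeight hk).mono_set Ioc_subset_Ioi_self).const_mul _) ?_
  · filter_upwards [ae_restrict_mem measurableSet_Ioc] with s hs
    have := chiWeight_pos k (mul_pos hr hs.1)
    have := chiWeight_pos k hy
    simp only [Pi.zero_apply]
    positivity
  · filter_upwards [ae_restrict_mem measurableSet_Ioc] with s hs
    have := mul_chiWeight_mul_le k hr hy hs.1 (mul_nonpos_of_nonneg_of_nonpos
      (by nlinarith) (by nlinarith [hs.1, hs.2]))
    rwa [hry] at this

theorem integral_Ioi_chiWeight_mul_le {k x y : ℝ} (hk : 0 < k) (hx : 0 < x) (hxy : x ≤ y) :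
    (∫ t in Ioi y, chiWeight k t) * (x * chiWeight k x) ≤
      y * chiWeight k y * ∫ t in Ioi x, chiWeight k t := by
  have hy := hx.trans_le hxy
  have hr : 0 < y / x := by positivity
  have hry : y / x * x = y := by field_simp
  have hr1 : 1 ≤ y / x := (one_le_div hx).2 hxy
  have hsub := integral_comp_mul_left_Ioi (chiWeight k) x hr
  rw [hry, smul_eq_mul, eq_inv_mul_iff_mul_eq₀ hr.ne'] at hsub
  rw [← hsub, ← integral_const_mul, ← integral_const_mul, ← integral_mul_const]
  refine integral_mono_of_nonneg ?_
    (((integrableOn_chiWeight hk).mono_set (Ioi_subset_Ioi hx.le)).const_mul _) ?_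
  · filter_upwards [ae_restrict_mem measurableSet_Ioi] with s hs
    have := chiWeight_pos k (mul_pos hr (hx.trans hs))
    have := chiWeight_pos k hx
    simp only [Pi.zero_apply]
    positivity
  · filter_upwards [ae_restrict_mem measurableSet_Ioi] with s (hs : x < s)
    have := mul_chiWeight_mul_le k hr hx (hx.trans hs) (mul_nonpos_of_nonpos_of_nonneg
      (by nlinarith) (by nlinarith))
    rwa [hry] at this

section CenteredIntegral

variable {k M : ℝ} {q : ℝ → ℝ}

theorem integrableOn_mul_chiWeight (hk : 0 < k) (hq : Measurable q)
    (hM : ∀ x, 0 < x → |q x| ≤ M) : IntegrableOn (fun t => q t * chiWeight k t) (Ioi 0) :=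
  (integrableOn_chiWeight hk).bdd_mul hq.aestronglyMeasurable
    (ae_restrict_of_forall_mem measurableSet_Ioi fun x hx => hM x hx)

theorem abs_setIntegral_mul_chiWeight_le (hk : 0 < k) (hM : ∀ x, 0 < x → |q x| ≤ M) {s : Set ℝ}
    (hs : MeasurableSet s) (hs0 : s ⊆ Ioi 0) :
    |∫ t in s, q t * chiWeight k t| ≤ M * ∫ t in s, chiWeight k t := by
  rw [← integral_const_mul, ← Real.norm_eq_abs]
  refine norm_integral_le_of_norm_le (((integrableOn_chiWeight hk).mono_set hs0).const_mul M)
    (ae_restrict_of_forall_mem hs fun t ht => ?_)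
  have := chiWeight_pos k (hs0 ht)
  rw [norm_mul, Real.norm_eq_abs, Real.norm_eq_abs, abs_of_pos this]
  exact mul_le_mul_of_nonneg_right (hM t (hs0 ht)) this.le

theorem abs_integral_Ioc_mul_chiWeight_le_integral_Ioi (hk : 0 < k) (hq : Measurable q)
    (hM : ∀ x, 0 < x → |q x| ≤ M) (h0 : ∫ t in Ioi (0 : ℝ), q t * chiWeight k t = 0) {x : ℝ}
    (hx : 0 < x) :
    |∫ t in Ioc 0 x, q t * chiWeight k t| ≤ M * ∫ t in Ioi x, chiWeight k t := by
  have hint := integrableOn_mul_chiWeight hk hq hM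
  rw [← Ioc_union_Ioi_eq_Ioi hx.le, setIntegral_union (Ioc_disjoint_Ioi le_rfl) measurableSet_Ioi
    (hint.mono_set Ioc_subset_Ioi_self) (hint.mono_set (Ioi_subset_Ioi hx.le))] at h0
  rw [eq_neg_of_add_eq_zero_left h0, abs_neg]
  exact abs_setIntegral_mul_chiWeight_le hk hM measurableSet_Ioi (Ioi_subset_Ioi hx.le)

theorem abs_sub_sq_mul_abs_integral_Ioc_le (hk : 0 < k) (hq : Measurable q)
    (hM : ∀ x, 0 < x → |q x| ≤ M) (h0 : ∫ t in Ioi (0 : ℝ), q t * chiWeight k t = 0) {x : ℝ}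
    (hx : 0 < x) :
    |k - x ^ 2| * |∫ t in Ioc 0 x, q t * chiWeight k t| ≤ M * (x * chiWeight k x) := by
  have hM0 : 0 ≤ M := (abs_nonneg _).trans (hM 1 one_pos)
  rcases le_total (x ^ 2) k with h | h
  · rw [abs_of_nonneg (sub_nonneg.2 h)]
    have h₁ := abs_setIntegral_mul_chiWeight_le (s := Ioc 0 x) hk hM measurableSet_Ioc
      Ioc_subset_Ioi_self
    have h₂ := mul_le_mul_of_nonneg_left (sub_sq_mul_integral_Ioc_chiWeight_le hk hx) hM0
    have h₃ := mul_le_mul_of_nonneg_left h₁ (sub_nonneg.2 h)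
    linarith
  · rw [abs_of_nonpos (sub_nonpos.2 h), neg_sub]
    have h₁ := abs_integral_Ioc_mul_chiWeight_le_integral_Ioi hk hq hM h0 hx
    have h₂ := mul_le_mul_of_nonneg_left (sq_sub_mul_integral_Ioi_chiWeight_le hk hx) hM0
    have h₃ := mul_le_mul_of_nonneg_left h₁ (sub_nonneg.2 h)
    linarith

theorem abs_integral_Ioc_mul_le (hk : 0 < k) (hq : Measurable q)
    (hM : ∀ x, 0 < x → |q x| ≤ M) (h0 : ∫ t in Ioi (0 : ℝ), q t * chiWeight k t = 0) {x y : ℝ}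
    (hx : 0 < x) (hy : 0 < y) :
    |∫ t in Ioc 0 x, q t * chiWeight k t| * (y * chiWeight k y) ≤
      M * (x * chiWeight k x) * ∫ t in Ioi (0 : ℝ), chiWeight k t := by
  have hM0 : 0 ≤ M := (abs_nonneg _).trans (hM 1 one_pos)
  have hxw := mul_pos hx (chiWeight_pos k hx)
  have hyw := mul_pos hy (chiWeight_pos k hy)
  have hmono : ∀ s : Set ℝ, s ⊆ Ioi 0 →
      ∫ t in s, chiWeight k t ≤ ∫ t in Ioi (0 : ℝ), chiWeight k t := fun s hs =>
    setIntegral_mono_set (integrableOn_chiWeight hk)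
      (ae_restrict_of_forall_mem measurableSet_Ioi fun t ht => (chiWeight_pos k ht).le)
      hs.eventuallyLE
  rcases le_total x y with h | h
  · have h₁ := mul_le_mul_of_nonneg_right (abs_setIntegral_mul_chiWeight_le (s := Ioc 0 x) hk hM
      measurableSet_Ioc Ioc_subset_Ioi_self) hyw.le
    have h₂ := mul_le_mul_of_nonneg_left (integral_Ioc_chiWeight_mul_le hk hx h) hM0
    have h₃ := mul_le_mul_of_nonneg_left (hmono (Ioc 0 y) Ioc_subset_Ioi_self)
      (mul_nonneg hM0 hxw.le)
    linarith
  · have h₁ := mul_le_mul_of_nonneg_right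
      (abs_integral_Ioc_mul_chiWeight_le_integral_Ioi hk hq hM h0 hx) hyw.le
    have h₂ := mul_le_mul_of_nonneg_left (integral_Ioi_chiWeight_mul_le hk hy h) hM0
    have h₃ := mul_le_mul_of_nonneg_left (hmono (Ioi y) (Ioi_subset_Ioi hy.le))
      (mul_nonneg hM0 hxw.le)
    linarith

theorem hasDerivAt_integral_Ioc_chiWeight (hk : 0 < k) {x : ℝ} (hx : 0 < x) :
    HasDerivAt (fun y => ∫ t in Ioc 0 y, chiWeight k t) (chiWeight k x) x := by
  have h := intervalIntegral.integral_hasDerivAt_right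
    ((intervalIntegrable_iff_integrableOn_Ioc_of_le hx.le).2
      ((integrableOn_chiWeight hk).mono_set Ioc_subset_Ioi_self))
    ((continuousOn_chiWeight k).stronglyMeasurableAtFilter isOpen_Ioi x hx)
    ((continuousOn_chiWeight k).continuousAt (Ioi_mem_nhds hx))
  refine h.congr_of_eventuallyEq ?_
  filter_upwards [Ioi_mem_nhds hx] with y (hy : 0 < y)
  rw [intervalIntegral.integral_of_le hy.le]

theorem monotone_mul_integral_Ioc_add (hk : 0 < k) (hq : Measurable q)
    (hM : ∀ x, 0 < x → |q x| ≤ M) :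
    Monotone fun y => M * (∫ t in Ioc 0 y, chiWeight k t) +
      ∫ t in Ioc 0 y, q t * chiWeight k t := by
  have hw := (integrableOn_chiWeight hk).const_mul M
  have hint := integrableOn_mul_chiWeight hk hq hM
  have e : ∀ y, M * (∫ t in Ioc 0 y, chiWeight k t) + ∫ t in Ioc 0 y, q t * chiWeight k t =
      ∫ t in Ioc 0 y, (M * chiWeight k t + q t * chiWeight k t) := fun y => by
    rw [integral_add (IntegrableOn.mono_set hw Ioc_subset_Ioi_self)
      (hint.mono_set Ioc_subset_Ioi_self), integral_const_mul]
  simp only [e]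
  refine fun y z hyz => setIntegral_mono_set
    (IntegrableOn.mono_set (hw.add hint) Ioc_subset_Ioi_self)
    (ae_restrict_of_forall_mem measurableSet_Ioc fun t ht => ?_)
    (Ioc_subset_Ioc_right hyz).eventuallyLE
  simp only [Pi.zero_apply, ← add_mul]
  exact mul_nonneg (by linarith [neg_abs_le (q t), hM t ht.1]) (chiWeight_pos k ht.1).le

theorem abs_le_of_hasDerivAt_integral_Ioc (hk : 0 < k) (hq : Measurable q)
    (hM : ∀ x, 0 < x → |q x| ≤ M) {x d : ℝ} (hx : 0 < x)
    (hd : HasDerivAt (fun y => ∫ t in Ioc 0 y, q t * chiWeight k t) d x) :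
    |d| ≤ M * chiWeight k x := by
  have hP := (hasDerivAt_integral_Ioc_chiWeight hk hx).const_mul M
  have h₁ := (monotone_mul_integral_Ioc_add hk hq hM).deriv_nonneg (x := x)
  have h₂ := (monotone_mul_integral_Ioc_add hk hq.neg
    (fun y hy => by simpa using hM y hy)).deriv_nonneg (x := x)
  have hd' : HasDerivAt (fun y => ∫ t in Ioc 0 y, (-q) t * chiWeight k t) (-d) x := by
    simpa only [Pi.neg_apply, neg_mul, integral_neg] using! hd.neg
  rw [(hP.fun_add hd).deriv] at h₁
  rw [(hP.fun_add hd').deriv] at h₂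
  exact abs_le.2 ⟨by linarith, by linarith⟩

theorem abs_mul_deriv_le_of_stein_solution (hk : 0 < k) (hq : Measurable q)
    (hM : ∀ x, 0 < x → |q x| ≤ M) (h0 : ∫ t in Ioi (0 : ℝ), q t * chiWeight k t = 0)
    {f : ℝ → ℝ} (hf : ∀ x, 0 < x →
      x * chiWeight k x * f x = ∫ t in Ioc 0 x, q t * chiWeight k t) {x : ℝ} (hx : 0 < x) :
    |x * deriv f x| ≤ 2 * M := by
  have hM0 : 0 ≤ M := (abs_nonneg _).trans (hM 1 one_pos)
  by_cases hfd : DifferentiableAt ℝ f x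
  swap
  · simpa [deriv_zero_of_not_differentiableAt hfd] using hM0
  have hw := chiWeight_pos k hx
  have hG : HasDerivAt (fun y => ∫ t in Ioc 0 y, q t * chiWeight k t)
      ((k - x ^ 2) * chiWeight k x * f x + x * chiWeight k x * deriv f x) x := by
    rw [mul_chiWeight k hx]
    refine ((hasDerivAt_rpow_mul_exp_neg_sq_div_two k hx).mul
      hfd.hasDerivAt).congr_of_eventuallyEq ?_
    filter_upwards [Ioi_mem_nhds hx] with y (hy : 0 < y)
    rw [← hf y hy, mul_chiWeight k hy, Pi.mul_apply]
  have h₁ := abs_le_of_hasDerivAt_integral_Ioc hk hq hM hx hG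
  have h₂ := abs_sub_sq_mul_abs_integral_Ioc_le hk hq hM h0 hx
  rw [← hf x hx, ← abs_mul] at h₂
  have h₃ : |(k - x ^ 2) * f x| ≤ M := by
    refine le_of_mul_le_mul_right ?_ (mul_pos hx hw)
    rwa [← abs_of_pos (mul_pos hx hw), ← abs_mul, mul_assoc, mul_comm (f x),
      abs_of_pos (mul_pos hx hw)]
  have h₄ : |(k - x ^ 2) * f x + x * deriv f x| ≤ M := by
    refine le_of_mul_le_mul_right ?_ hw
    rwa [← abs_of_pos hw, ← abs_mul, abs_of_pos hw, add_mul, mul_right_comm,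
      mul_right_comm x]
  have h₅ := abs_sub ((k - x ^ 2) * f x + x * deriv f x) ((k - x ^ 2) * f x)
  rw [add_sub_cancel_left] at h₅
  linarith

end CenteredIntegral

theorem sqrt_mul_chiWeight_sqrt {k : ℝ} (hk : 0 < k) :
    √k * chiWeight k √k = k ^ (k / 2) * Real.exp (-(k / 2)) := by
  rw [mul_chiWeight k (Real.sqrt_pos.2 hk), Real.sq_sqrt hk.le, Real.sqrt_eq_rpow,
    ← Real.rpow_mul hk.le, one_div_mul_eq_div, neg_div]

/-- Lemma 5.2: bounds on the solution of the chi distribution Stein equation for bounded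
test functions. -/
theorem chi_stein_solution_bounds (k : ℝ) (hk : 0 < k)
    (ρ : ℝ → ℝ)
    (hρ : ∀ x, ρ x = x ^ (k - 1) * Real.exp (-x ^ 2 / 2)
        / ((2 : ℝ) ^ (k / 2 - 1) * Real.Gamma (k / 2)))
    (χm : Measure ℝ)
    (hχm : χm = (volume : Measure ℝ).withDensity fun x =>
        ENNReal.ofReal (if 0 < x then ρ x else 0))
    (h : ℝ → ℝ) (hmeas : Measurable h)
    (C : ℝ) (hbd : ∀ x, 0 < x → |h x| ≤ C)
    (f : ℝ → ℝ)
    (hf : ∀ x, 0 < x →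
      f x = 1 / (x * ρ x) * ∫ t in Ioc (0 : ℝ) x, (h t - ∫ z, h z ∂χm) * ρ t) :
    (∀ x, 0 < x → |f x| ≤
        Real.Gamma (k / 2) * Real.exp (k / 2) / (2 * (k / 2) ^ (k / 2))
          * ⨆ y : {y : ℝ // 0 < y}, |h y.1 - ∫ z, h z ∂χm|) ∧
    (∀ x, 0 < x → |x * deriv f x| ≤
        2 * ⨆ y : {y : ℝ // 0 < y}, |h y.1 - ∫ z, h z ∂χm|) := by
  set Z : ℝ := (2 : ℝ) ^ (k / 2 - 1) * Real.Gamma (k / 2) with hZ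
  have hZ0 : 0 < Z := mul_pos (by positivity) (Real.Gamma_pos_of_pos (by positivity))
  have hρw : ∀ x, ρ x = chiWeight k x / Z := fun x => by rw [hρ x, chiWeight]
  have hρ_pos : ∀ x, 0 < x → 0 < ρ x := fun x hx => by
    rw [hρw]
    exact div_pos (chiWeight_pos k hx) hZ0
  have hρ_eq : ρ = fun x => chiWeight k x / Z := funext hρw
  have hρ_int : IntegrableOn ρ (Ioi 0) := hρ_eq ▸ (integrableOn_chiWeight hk).div_const Z
  have hρ_one : ∫ t in Ioi (0 : ℝ), ρ t = 1 := by
    rw [hρ_eq, integral_div, integral_chiWeight hk, div_self hZ0.ne']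
  have hE : ∫ z, h z ∂χm = ∫ t in Ioi (0 : ℝ), h t * ρ t := by
    have hρ_meas : Measurable ρ := by
      rw [hρ_eq]
      unfold chiWeight
      fun_prop
    rw [hχm, integral_withDensity_eq_integral_toReal_smul
      (Measurable.ite measurableSet_Ioi hρ_meas measurable_const).ennreal_ofReal
      (Eventually.of_forall fun _ => ENNReal.ofReal_lt_top), ← integral_indicator measurableSet_Ioi]
    refine integral_congr_ae (Eventually.of_forall fun t => ?_)
    by_cases ht : 0 < t
    · simp [ht, (hρ_pos t ht).le, mul_comm]
    · simp [ht]
  set E : ℝ := ∫ z, h z ∂χm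
  set M : ℝ := ⨆ y : {y : ℝ // 0 < y}, |h y.1 - E|
  have hq : Measurable fun t => h t - E := hmeas.sub_const E
  have hM : ∀ x, 0 < x → |h x - E| ≤ M := fun x hx => by
    refine le_ciSup (f := fun y : {y : ℝ // 0 < y} => |h y.1 - E|) ⟨C + |E|, ?_⟩ ⟨x, hx⟩
    rintro _ ⟨y, rfl⟩
    exact (abs_sub _ _).trans (by linarith [hbd y.1 y.2])
  have h0 : ∫ t in Ioi (0 : ℝ), (h t - E) * chiWeight k t = 0 := by
    have hhρ : IntegrableOn (fun t => h t * ρ t) (Ioi 0) :=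
      hρ_int.bdd_mul hmeas.aestronglyMeasurable
        (ae_restrict_of_forall_mem measurableSet_Ioi fun x hx => hbd x hx)
    have hc : ∫ t in Ioi (0 : ℝ), (h t - E) * ρ t = 0 := by
      simp only [sub_mul]
      rw [integral_sub hhρ (hρ_int.const_mul E), integral_const_mul, hρ_one, ← hE]
      ring
    simp only [hρw, ← mul_div_assoc] at hc
    rw [integral_div] at hc
    simpa [hZ0.ne'] using hc
  have hfw : ∀ x, 0 < x →
      x * chiWeight k x * f x = ∫ t in Ioc 0 x, (h t - E) * chiWeight k t := fun x hx => by
    have hw := (chiWeight_pos k hx).ne'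
    rw [hf x hx]
    simp only [hρw, ← mul_div_assoc]
    rw [integral_div]
    field_simp
  refine ⟨fun x hx => ?_, fun x hx => abs_mul_deriv_le_of_stein_solution hk hq hM h0 hfw hx⟩
  have hxw := mul_pos hx (chiWeight_pos k hx)
  have hs := Real.sqrt_pos.2 hk
  have h₁ := abs_integral_Ioc_mul_le hk hq hM h0 hx hs
  rw [← hfw x hx, abs_mul, abs_of_pos hxw, integral_chiWeight hk, ← hZ,
    sqrt_mul_chiWeight_sqrt hk] at h₁
  have h₂ : |f x| * (k ^ (k / 2) * Real.exp (-(k / 2))) ≤ M * Z :=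
    le_of_mul_le_mul_left (by linarith) hxw
  rw [← le_div_iff₀ (by positivity)] at h₂
  refine h₂.trans_eq ?_
  rw [hZ, Real.rpow_sub_one two_ne_zero, Real.div_rpow hk.le zero_le_two, Real.exp_neg]
  field_simp
end
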